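/- Error estimate for the smooth component: there exists a constant C, independent of ε_1,…,ε_n, M and N (depending only on n, α, T and on the data A, f and the boundary/initial functions), such that ‖V − v‖ ≤ C(M^{−1} + N^{−2}(ln N)³), where v is the smooth component of the exact solution, V is the mesh function solving L^{M,N}V = f at the interior points of the Shishkin mesh with V = v at the boundary mesh points, and ‖·‖ is the maximum over all mesh points of the largest component absolute value. -/

import Mathlib

/-- Auxiliary downward recursion for the Shishkin transition parameters:
`shishkinSigmaAux α lnN ε n m = σ_{n-m}`. -/
noncomputable def shishkinSigmaAux (α lnN : ℝ) (ε : ℕ → ℝ) (n : ℕ) : ℕ → ℝ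
  | 0 => min (1 / 4) (2 * Real.sqrt (ε n / α) * lnN)
  | m + 1 => min (shishkinSigmaAux α lnN ε n m / 2)
      (2 * Real.sqrt (ε (n - (m + 1)) / α) * lnN)

/-- The Shishkin transition parameter `σ_r` (for `1 ≤ r ≤ n`), with the
convention `σ_0 = 0`. -/
noncomputable def shishkinSigma (α N : ℝ) (ε : ℕ → ℝ) (n r : ℕ) : ℝ :=
  if r = 0 then 0 else shishkinSigmaAux α (Real.log N) ε n (n - r)

/-- The mesh index of the transition point `σ_r`: on the Shishkin mesh with
`N = 2^{n+p+1}` intervals, `σ_r` is the mesh point with index `2^{r+p-1}`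
(and `σ_0 = 0` has index `0`). -/
def meshIdx (p r : ℕ) : ℕ := if r = 0 then 0 else 2 ^ (r + p - 1)

/-- `xm : ℕ → ℝ` is the piecewise-uniform Shishkin mesh on `[0,1]` with
`N = 2^{n+p+1}` mesh intervals: it is uniform with `N/2^{n+1}` intervals on
`[0,σ₁]`, `N/2^{n-r+2}` intervals on `(σ_r,σ_{r+1}]`, `N/2` intervals on
`(σ_n, 1−σ_n]`, and is symmetric about `1/2`. -/
def IsShishkinMesh (α : ℝ) (ε : ℕ → ℝ) (n p N : ℕ) (xm : ℕ → ℝ) : Prop :=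
  xm 0 = 0 ∧ xm N = 1 ∧
  (∀ r : ℕ, 1 ≤ r → r ≤ n → ∀ j : ℕ, meshIdx p (r - 1) ≤ j → j ≤ meshIdx p r →
    xm j = shishkinSigma α (N : ℝ) ε n (r - 1)
      + ((j - meshIdx p (r - 1) : ℕ) : ℝ)
          / ((meshIdx p r - meshIdx p (r - 1) : ℕ) : ℝ)
          * (shishkinSigma α (N : ℝ) ε n r - shishkinSigma α (N : ℝ) ε n (r - 1))) ∧
  (∀ j : ℕ, N / 4 ≤ j → j ≤ N - N / 4 →
    xm j = shishkinSigma α (N : ℝ) ε n n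
      + ((j - N / 4 : ℕ) : ℝ) / ((N / 2 : ℕ) : ℝ)
          * (1 - 2 * shishkinSigma α (N : ℝ) ε n n)) ∧
  (∀ j ≤ N, xm (N - j) = 1 - xm j)

/-- The discrete operator `L^{M,N}` applied to the vector mesh function `Ψ`
(component `i`, space index `j`, time index `k`), on the mesh
`x : ℕ → ℝ`, `t : ℕ → ℝ`:
`L^{M,N}Ψ = D_t⁻ Ψ − ε_i δ_x² Ψ + Σ_l a_il Ψ_l`. -/
noncomputable def discreteL (n : ℕ) (ε : ℕ → ℝ) (A : ℕ → ℕ → ℝ → ℝ → ℝ)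
    (x t : ℕ → ℝ) (Ψ : ℕ → ℕ → ℕ → ℝ) (i j k : ℕ) : ℝ :=
  (Ψ i j k - Ψ i j (k - 1)) / (t k - t (k - 1))
    - ε i * (((Ψ i (j + 1) k - Ψ i j k) / (x (j + 1) - x j)
          - (Ψ i j k - Ψ i (j - 1) k) / (x j - x (j - 1)))
        / ((x (j + 1) - x (j - 1)) / 2))
    + ∑ l ∈ Finset.Icc 1 n, A i l (x j) (t k) * Ψ l j k

/-- The partial derivative with respect to the first variable. -/
noncomputable def Dx (g : ℝ → ℝ → ℝ) : ℝ → ℝ → ℝ := fun x t => deriv (fun y => g y t) x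

/-- The partial derivative with respect to the second variable. -/
noncomputable def Dt (g : ℝ → ℝ → ℝ) : ℝ → ℝ → ℝ := fun x t => deriv (fun s => g x s) t

/-- A function of two real variables that is smooth on the plane. -/
def Smooth2 (g : ℝ → ℝ → ℝ) : Prop := ContDiff ℝ (⊤ : ℕ∞) (fun q : ℝ × ℝ => g q.1 q.2)

/-- `|g| ≤ K` on the closed rectangle `[0,1] × [0,T]`. -/
def BddOnRect (T : ℝ) (g : ℝ → ℝ → ℝ) (K : ℝ) : Prop :=
  ∀ x ∈ Set.Icc (0:ℝ) 1, ∀ t ∈ Set.Icc (0:ℝ) T, |g x t| ≤ K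

/-- `g = h` on the closed rectangle `[0,1] × [0,T]`. -/
def EqOnRect (T : ℝ) (g h : ℝ → ℝ → ℝ) : Prop :=
  ∀ x ∈ Set.Icc (0:ℝ) 1, ∀ t ∈ Set.Icc (0:ℝ) T, g x t = h x t

namespace Smooth2

variable {g h : ℝ → ℝ → ℝ}

lemma continuous (hg : Smooth2 g) : Continuous (fun q : ℝ × ℝ => g q.1 q.2) :=
  ContDiff.continuous hg

lemma differentiable (hg : Smooth2 g) : Differentiable ℝ (fun q : ℝ × ℝ => g q.1 q.2) :=
  ContDiff.differentiable hg (by simp)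

lemma hasDerivAt_fst (hg : Smooth2 g) (x t : ℝ) :
    HasDerivAt (fun y => g y t) (fderiv ℝ (fun q : ℝ × ℝ => g q.1 q.2) (x, t) (1, 0)) x :=
  HasFDerivAt.comp_hasDerivAt (l := fun q : ℝ × ℝ => g q.1 q.2) (f := fun y => (y, t)) x
    (hg.differentiable (x, t)).hasFDerivAt ((hasDerivAt_id x).prodMk (hasDerivAt_const x t))

lemma hasDerivAt_snd (hg : Smooth2 g) (x t : ℝ) :
    HasDerivAt (fun s => g x s) (fderiv ℝ (fun q : ℝ × ℝ => g q.1 q.2) (x, t) (0, 1)) t :=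
  (hg.differentiable (x, t)).hasFDerivAt.comp_hasDerivAt t
    ((hasDerivAt_const t x).prodMk (hasDerivAt_id t))

lemma Dx_eq (hg : Smooth2 g) (x t : ℝ) :
    Dx g x t = fderiv ℝ (fun q : ℝ × ℝ => g q.1 q.2) (x, t) (1, 0) :=
  (hg.hasDerivAt_fst x t).deriv

lemma Dt_eq (hg : Smooth2 g) (x t : ℝ) :
    Dt g x t = fderiv ℝ (fun q : ℝ × ℝ => g q.1 q.2) (x, t) (0, 1) :=
  (hg.hasDerivAt_snd x t).deriv

lemma hasDerivAt_Dx (hg : Smooth2 g) (x t : ℝ) : HasDerivAt (fun y => g y t) (Dx g x t) x := by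
  rw [hg.Dx_eq]; exact hg.hasDerivAt_fst x t

lemma hasDerivAt_Dt (hg : Smooth2 g) (x t : ℝ) : HasDerivAt (fun s => g x s) (Dt g x t) t := by
  rw [hg.Dt_eq]; exact hg.hasDerivAt_snd x t

lemma contDiff_fderiv (hg : Smooth2 g) :
    ContDiff ℝ (⊤ : ℕ∞) (fderiv ℝ (fun q : ℝ × ℝ => g q.1 q.2)) :=
  ContDiff.fderiv_right hg (by simp)

lemma dx (hg : Smooth2 g) : Smooth2 (Dx g) := by
  have : (fun q : ℝ × ℝ => Dx g q.1 q.2)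
      = fun q => fderiv ℝ (fun q : ℝ × ℝ => g q.1 q.2) q (1, 0) := by
    ext q; exact hg.Dx_eq q.1 q.2
  unfold Smooth2
  rw [this]
  exact hg.contDiff_fderiv.clm_apply contDiff_const

lemma dt (hg : Smooth2 g) : Smooth2 (Dt g) := by
  have : (fun q : ℝ × ℝ => Dt g q.1 q.2)
      = fun q => fderiv ℝ (fun q : ℝ × ℝ => g q.1 q.2) q (0, 1) := by
    ext q; exact hg.Dt_eq q.1 q.2
  unfold Smooth2
  rw [this]
  exact hg.contDiff_fderiv.clm_apply contDiff_const

lemma Dx_Dt_comm (hg : Smooth2 g) : Dx (Dt g) = Dt (Dx g) := by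
  have e1 : (fun q : ℝ × ℝ => Dt g q.1 q.2)
      = fun q => fderiv ℝ (fun q : ℝ × ℝ => g q.1 q.2) q (0, 1) := by
    ext q; exact hg.Dt_eq q.1 q.2
  have e2 : (fun q : ℝ × ℝ => Dx g q.1 q.2)
      = fun q => fderiv ℝ (fun q : ℝ × ℝ => g q.1 q.2) q (1, 0) := by
    ext q; exact hg.Dx_eq q.1 q.2
  ext x t
  have hd : DifferentiableAt ℝ (fderiv ℝ (fun q : ℝ × ℝ => g q.1 q.2)) (x, t) :=
    hg.contDiff_fderiv.differentiable (by simp) _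
  have hs : IsSymmSndFDerivAt ℝ (fun q : ℝ × ℝ => g q.1 q.2) (x, t) :=
    (ContDiff.contDiffAt hg).isSymmSndFDerivAt
      (by rw [minSmoothness_of_isRCLikeNormedField]; exact WithTop.coe_le_coe.2 le_top)
  rw [hg.dt.Dx_eq, hg.dx.Dt_eq, e1, e2, fderiv_clm_apply hd (by fun_prop),
    fderiv_clm_apply hd (by fun_prop)]
  simpa using hs (1, 0) (0, 1)

lemma add (hg : Smooth2 g) (hh : Smooth2 h) : Smooth2 (fun x t => g x t + h x t) :=
  ContDiff.add hg hh

lemma sub (hg : Smooth2 g) (hh : Smooth2 h) : Smooth2 (fun x t => g x t - h x t) :=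
  ContDiff.sub hg hh

lemma mul (hg : Smooth2 g) (hh : Smooth2 h) : Smooth2 (fun x t => g x t * h x t) :=
  ContDiff.mul hg hh

lemma const_mul (c : ℝ) (hg : Smooth2 g) : Smooth2 (fun x t => c * g x t) :=
  ContDiff.mul contDiff_const hg

lemma sum {s : Finset ℕ} {g : ℕ → ℝ → ℝ → ℝ} (hg : ∀ i ∈ s, Smooth2 (g i)) :
    Smooth2 (fun x t => ∑ i ∈ s, g i x t) :=
  ContDiff.sum hg

/-- A smooth function is bounded on the closed rectangle. -/
lemma exists_bdd (T : ℝ) (hg : Smooth2 g) : ∃ K, BddOnRect T g K := by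
  obtain ⟨K, hK⟩ := ((isCompact_Icc (a := (0:ℝ)) (b := 1)).prod
    (isCompact_Icc (a := (0:ℝ)) (b := T))).exists_bound_of_continuousOn hg.continuous.continuousOn
  exact ⟨K, fun x hx t ht => by simpa using hK (x, t) ⟨hx, ht⟩⟩

/-- A finite family of smooth functions has a common bound on the closed rectangle. -/
lemma exists_bdd_family (T : ℝ) {s : Finset ℕ} {g : ℕ → ℝ → ℝ → ℝ}
    (hg : ∀ i ∈ s, Smooth2 (g i)) : ∃ K, 0 ≤ K ∧ ∀ i ∈ s, BddOnRect T (g i) K := by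
  choose! K hK using fun i hi => (hg i hi).exists_bdd T
  refine ⟨∑ i ∈ s, |K i|, Finset.sum_nonneg fun _ _ => abs_nonneg _, fun i hi x hx t ht => ?_⟩
  calc |g i x t| ≤ |K i| := (hK i hi x hx t ht).trans (le_abs_self _)
    _ ≤ _ := Finset.single_le_sum (f := fun i => |K i|) (fun _ _ => abs_nonneg _) hi

/-- A finite double family of smooth functions has a common bound on the closed rectangle. -/
lemma exists_bdd_family₂ (T : ℝ) {s : Finset ℕ} {g : ℕ → ℕ → ℝ → ℝ → ℝ}
    (hg : ∀ i ∈ s, ∀ j ∈ s, Smooth2 (g i j)) :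
    ∃ K, 0 ≤ K ∧ ∀ i ∈ s, ∀ j ∈ s, BddOnRect T (g i j) K := by
  choose! K hK0 hK using fun i hi => exists_bdd_family T (hg i hi)
  refine ⟨∑ i ∈ s, |K i|, Finset.sum_nonneg fun _ _ => abs_nonneg _,
    fun i hi j hj x hx t ht => ?_⟩
  calc |g i j x t| ≤ |K i| := (hK i hi j hj x hx t ht).trans (le_abs_self _)
    _ ≤ _ := Finset.single_le_sum (f := fun i => |K i|) (fun _ _ => abs_nonneg _) hi

end Smooth2

section Derivatives

variable {g h : ℝ → ℝ → ℝ}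

lemma Dx_add (hg : Smooth2 g) (hh : Smooth2 h) :
    Dx (fun x t => g x t + h x t) = fun x t => Dx g x t + Dx h x t := by
  ext x t; exact ((hg.hasDerivAt_Dx x t).add (hh.hasDerivAt_Dx x t)).deriv

lemma Dx_sub (hg : Smooth2 g) (hh : Smooth2 h) :
    Dx (fun x t => g x t - h x t) = fun x t => Dx g x t - Dx h x t := by
  ext x t; exact ((hg.hasDerivAt_Dx x t).sub (hh.hasDerivAt_Dx x t)).deriv

lemma Dx_mul (hg : Smooth2 g) (hh : Smooth2 h) :
    Dx (fun x t => g x t * h x t) = fun x t => Dx g x t * h x t + g x t * Dx h x t := by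
  ext x t; exact ((hg.hasDerivAt_Dx x t).mul (hh.hasDerivAt_Dx x t)).deriv

lemma Dx_const_mul (c : ℝ) (hg : Smooth2 g) :
    Dx (fun x t => c * g x t) = fun x t => c * Dx g x t := by
  ext x t; exact ((hg.hasDerivAt_Dx x t).const_mul c).deriv

lemma Dx_sum {s : Finset ℕ} {g : ℕ → ℝ → ℝ → ℝ} (hg : ∀ i ∈ s, Smooth2 (g i)) :
    Dx (fun x t => ∑ i ∈ s, g i x t) = fun x t => ∑ i ∈ s, Dx (g i) x t := by
  ext x t; exact (HasDerivAt.fun_sum fun i hi => (hg i hi).hasDerivAt_Dx x t).deriv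

lemma Dt_add (hg : Smooth2 g) (hh : Smooth2 h) :
    Dt (fun x t => g x t + h x t) = fun x t => Dt g x t + Dt h x t := by
  ext x t; exact ((hg.hasDerivAt_Dt x t).add (hh.hasDerivAt_Dt x t)).deriv

lemma Dt_sub (hg : Smooth2 g) (hh : Smooth2 h) :
    Dt (fun x t => g x t - h x t) = fun x t => Dt g x t - Dt h x t := by
  ext x t; exact ((hg.hasDerivAt_Dt x t).sub (hh.hasDerivAt_Dt x t)).deriv

lemma Dt_mul (hg : Smooth2 g) (hh : Smooth2 h) :
    Dt (fun x t => g x t * h x t) = fun x t => Dt g x t * h x t + g x t * Dt h x t := by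
  ext x t; exact ((hg.hasDerivAt_Dt x t).mul (hh.hasDerivAt_Dt x t)).deriv

lemma Dt_const_mul (c : ℝ) (hg : Smooth2 g) :
    Dt (fun x t => c * g x t) = fun x t => c * Dt g x t := by
  ext x t; exact ((hg.hasDerivAt_Dt x t).const_mul c).deriv

lemma Dt_sum {s : Finset ℕ} {g : ℕ → ℝ → ℝ → ℝ} (hg : ∀ i ∈ s, Smooth2 (g i)) :
    Dt (fun x t => ∑ i ∈ s, g i x t) = fun x t => ∑ i ∈ s, Dt (g i) x t := by
  ext x t; exact (HasDerivAt.fun_sum fun i hi => (hg i hi).hasDerivAt_Dt x t).deriv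

/-- Continuous functions that agree on a nondegenerate open interval agree on its closure. -/
lemma eqOn_Icc_of_eqOn_Ioo {a b : ℝ} (hab : a < b) {φ ψ : ℝ → ℝ} (hφ : Continuous φ)
    (hψ : Continuous ψ) (h : ∀ x ∈ Set.Ioo a b, φ x = ψ x) : ∀ x ∈ Set.Icc a b, φ x = ψ x := by
  have := Set.EqOn.closure h hφ hψ
  rwa [closure_Ioo hab.ne] at this

/-- Derivatives of functions that agree on an interval agree there, up to the end points. -/
lemma deriv_eqOn_Icc {a b : ℝ} (hab : a < b) {φ ψ φ' ψ' : ℝ → ℝ}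
    (hφ : ∀ x, HasDerivAt φ (φ' x) x) (hψ : ∀ x, HasDerivAt ψ (ψ' x) x)
    (hφ' : Continuous φ') (hψ' : Continuous ψ') (h : ∀ x ∈ Set.Icc a b, φ x = ψ x) :
    ∀ x ∈ Set.Icc a b, φ' x = ψ' x := by
  refine eqOn_Icc_of_eqOn_Ioo hab hφ' hψ' fun x hx => ?_
  have he : φ =ᶠ[nhds x] ψ :=
    Filter.eventually_of_mem (isOpen_Ioo.mem_nhds hx) fun y hy => h y (Set.Ioo_subset_Icc_self hy)
  exact ((hφ x).congr_of_eventuallyEq he.symm).unique (hψ x)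

lemma Smooth2.continuous_fst (hg : Smooth2 g) (t : ℝ) : Continuous fun x => g x t :=
  hg.continuous.comp (by fun_prop : Continuous fun x : ℝ => (x, t))

lemma Smooth2.continuous_snd (hg : Smooth2 g) (x : ℝ) : Continuous fun t => g x t :=
  hg.continuous.comp (by fun_prop : Continuous fun t : ℝ => (x, t))

lemma Dx_eq_of_eq {t : ℝ} (hg : Smooth2 g) (hh : Smooth2 h)
    (e : ∀ x ∈ Set.Icc (0:ℝ) 1, g x t = h x t) : ∀ x ∈ Set.Icc (0:ℝ) 1, Dx g x t = Dx h x t :=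
  deriv_eqOn_Icc zero_lt_one (fun x => hg.hasDerivAt_Dx x t) (fun x => hh.hasDerivAt_Dx x t)
    (hg.dx.continuous_fst t) (hh.dx.continuous_fst t) e

lemma Dt_eq_of_eq {T x : ℝ} (hT : 0 < T) (hg : Smooth2 g) (hh : Smooth2 h)
    (e : ∀ t ∈ Set.Icc (0:ℝ) T, g x t = h x t) : ∀ t ∈ Set.Icc (0:ℝ) T, Dt g x t = Dt h x t :=
  deriv_eqOn_Icc hT (fun t => hg.hasDerivAt_Dt x t) (fun t => hh.hasDerivAt_Dt x t)
    (hg.dt.continuous_snd x) (hh.dt.continuous_snd x) e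

lemma EqOnRect.dx {T : ℝ} (e : EqOnRect T g h) (hg : Smooth2 g) (hh : Smooth2 h) :
    EqOnRect T (Dx g) (Dx h) :=
  fun x hx t ht => Dx_eq_of_eq hg hh (fun y hy => e y hy t ht) x hx

lemma EqOnRect.dt {T : ℝ} (hT : 0 < T) (e : EqOnRect T g h) (hg : Smooth2 g) (hh : Smooth2 h) :
    EqOnRect T (Dt g) (Dt h) :=
  fun x hx t ht => Dt_eq_of_eq hT hg hh (fun s hs => e x hx s hs) t ht

/-- Smooth functions that agree inside the rectangle agree on the closed rectangle. -/
lemma EqOnRect.of_interior {T : ℝ} (hT : 0 < T) (hg : Smooth2 g) (hh : Smooth2 h)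
    (e : ∀ x t : ℝ, 0 < x → x < 1 → 0 < t → t ≤ T → g x t = h x t) : EqOnRect T g h := by
  intro x hx t ht
  refine eqOn_Icc_of_eqOn_Ioo hT (hg.continuous_snd x) (hh.continuous_snd x)
    (fun s hs => ?_) t ht
  exact eqOn_Icc_of_eqOn_Ioo zero_lt_one (hg.continuous_fst s) (hh.continuous_fst s)
    (fun y hy => e y s hy.1 hy.2 hs.1 hs.2.le) x hx

end Derivatives

section Taylor

variable {g g₁ g₂ g₃ g₄ : ℝ → ℝ}

lemma abs_sub_le_of_deriv_le {K x y : ℝ} (hg : ∀ z, HasDerivAt g (g₁ z) z)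
    (hK : ∀ z ∈ Set.uIcc x y, |g₁ z| ≤ K) : |g y - g x| ≤ K * |y - x| :=
  Convex.norm_image_sub_le_of_norm_hasDerivWithin_le (fun z _ => (hg z).hasDerivWithinAt) hK
    (convex_uIcc x y) Set.left_mem_uIcc Set.right_mem_uIcc

lemma taylor_one {B x y : ℝ} (h0 : ∀ z, HasDerivAt g (g₁ z) z) (h1 : ∀ z, HasDerivAt g₁ (g₂ z) z)
    (hB : ∀ z ∈ Set.uIcc x y, |g₂ z| ≤ B) : |g y - g x - g₁ x * (y - x)| ≤ B * |y - x| ^ 2 := by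
  have hB0 : 0 ≤ B := (abs_nonneg _).trans (hB x Set.left_mem_uIcc)
  have hd : ∀ z, HasDerivAt (fun z => g z - g₁ x * (z - x)) (g₁ z - g₁ x) z := fun z => by
    simpa using (h0 z).fun_sub (((hasDerivAt_id z).sub_const x).const_mul (g₁ x))
  have := abs_sub_le_of_deriv_le (K := B * |y - x|) hd (x := x) (y := y) fun z hz => by
    refine (abs_sub_le_of_deriv_le h1 fun w hw =>
      hB w (Set.uIcc_subset_uIcc Set.left_mem_uIcc hz hw)).trans ?_
    exact mul_le_mul_of_nonneg_left (Set.abs_sub_left_of_mem_uIcc hz) hB0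
  calc _ = |g y - g₁ x * (y - x) - (g x - g₁ x * (x - x))| := by congr 1; ring
    _ ≤ _ := this
    _ = _ := by ring

lemma taylor_two {B x y : ℝ} (h0 : ∀ z, HasDerivAt g (g₁ z) z) (h1 : ∀ z, HasDerivAt g₁ (g₂ z) z)
    (h2 : ∀ z, HasDerivAt g₂ (g₃ z) z) (hB : ∀ z ∈ Set.uIcc x y, |g₃ z| ≤ B) :
    |g y - g x - g₁ x * (y - x) - g₂ x * (y - x) ^ 2 / 2| ≤ B * |y - x| ^ 3 := by
  have hB0 : 0 ≤ B := (abs_nonneg _).trans (hB x Set.left_mem_uIcc)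
  have hd : ∀ z, HasDerivAt (fun z => g z - g₁ x * (z - x) - g₂ x * (z - x) ^ 2 / 2)
      (g₁ z - g₁ x - g₂ x * (z - x)) z := fun z => by
    have e := ((h0 z).sub (((hasDerivAt_id z).sub_const x).const_mul (g₁ x))).sub
      (((((hasDerivAt_id z).sub_const x).pow 2).const_mul (g₂ x)).div_const 2)
    refine e.congr_deriv ?_
    simp only [id, Nat.cast_ofNat]; ring
  have := abs_sub_le_of_deriv_le (K := B * |y - x| ^ 2) hd (x := x) (y := y) fun z hz => by
    refine (taylor_one h1 h2 fun w hw =>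
      hB w (Set.uIcc_subset_uIcc Set.left_mem_uIcc hz hw)).trans ?_
    have := Set.abs_sub_left_of_mem_uIcc hz
    gcongr
  calc _ = |g y - g₁ x * (y - x) - g₂ x * (y - x) ^ 2 / 2
        - (g x - g₁ x * (x - x) - g₂ x * (x - x) ^ 2 / 2)| := by congr 1; ring
    _ ≤ _ := this
    _ = _ := by ring

lemma taylor_three {B x y : ℝ} (h0 : ∀ z, HasDerivAt g (g₁ z) z)
    (h1 : ∀ z, HasDerivAt g₁ (g₂ z) z) (h2 : ∀ z, HasDerivAt g₂ (g₃ z) z)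
    (h3 : ∀ z, HasDerivAt g₃ (g₄ z) z) (hB : ∀ z ∈ Set.uIcc x y, |g₄ z| ≤ B) :
    |g y - g x - g₁ x * (y - x) - g₂ x * (y - x) ^ 2 / 2 - g₃ x * (y - x) ^ 3 / 6|
      ≤ B * |y - x| ^ 4 := by
  have hB0 : 0 ≤ B := (abs_nonneg _).trans (hB x Set.left_mem_uIcc)
  have hd : ∀ z, HasDerivAt
      (fun z => g z - g₁ x * (z - x) - g₂ x * (z - x) ^ 2 / 2 - g₃ x * (z - x) ^ 3 / 6)
      (g₁ z - g₁ x - g₂ x * (z - x) - g₃ x * (z - x) ^ 2 / 2) z := fun z => by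
    have e := (((h0 z).sub (((hasDerivAt_id z).sub_const x).const_mul (g₁ x))).sub
      (((((hasDerivAt_id z).sub_const x).pow 2).const_mul (g₂ x)).div_const 2)).sub
      (((((hasDerivAt_id z).sub_const x).pow 3).const_mul (g₃ x)).div_const 6)
    refine e.congr_deriv ?_
    simp only [id, Nat.cast_ofNat]; ring
  have := abs_sub_le_of_deriv_le (K := B * |y - x| ^ 3) hd (x := x) (y := y) fun z hz => by
    refine (taylor_two h1 h2 h3 fun w hw =>
      hB w (Set.uIcc_subset_uIcc Set.left_mem_uIcc hz hw)).trans ?_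
    have := Set.abs_sub_left_of_mem_uIcc hz
    gcongr
  calc _ = |g y - g₁ x * (y - x) - g₂ x * (y - x) ^ 2 / 2 - g₃ x * (y - x) ^ 3 / 6
        - (g x - g₁ x * (x - x) - g₂ x * (x - x) ^ 2 / 2 - g₃ x * (x - x) ^ 3 / 6)| := by
          congr 1; ring
    _ ≤ _ := this
    _ = _ := by ring

/-- Interpolation of the first derivative between the function and its second derivative. -/
lemma abs_deriv_le_interpolation {B₀ B₂ δ : ℝ} (hδ : 0 < δ) (hδ' : δ ≤ 1 / 2)
    (h0 : ∀ z, HasDerivAt g (g₁ z) z) (h1 : ∀ z, HasDerivAt g₁ (g₂ z) z)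
    (hB₀ : ∀ z ∈ Set.Icc (0:ℝ) 1, |g z| ≤ B₀) (hB₂ : ∀ z ∈ Set.Icc (0:ℝ) 1, |g₂ z| ≤ B₂)
    {x : ℝ} (hx : x ∈ Set.Icc (0:ℝ) 1) : |g₁ x| ≤ 2 * B₀ / δ + B₂ * δ := by
  obtain ⟨y, hy, hyx⟩ : ∃ y ∈ Set.Icc (0:ℝ) 1, |y - x| = δ := by
    rcases le_total x (1 / 2) with h | h
    · exact ⟨x + δ, ⟨by linarith [hx.1], by linarith⟩, by simp [abs_of_pos hδ]⟩
    · exact ⟨x - δ, ⟨by linarith, by linarith [hx.2]⟩, by simp [abs_of_pos hδ]⟩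
  have ht := taylor_one h0 h1 fun z hz => hB₂ z (Set.uIcc_subset_Icc hx hy hz)
  rw [hyx] at ht
  have h3 : |g₁ x| * δ ≤ 2 * B₀ + B₂ * δ ^ 2 := by
    rw [← hyx, ← abs_mul, hyx]
    have := abs_le.1 ht
    have := abs_le.1 (hB₀ x hx)
    have := abs_le.1 (hB₀ y hy)
    rw [abs_le]
    constructor <;> linarith
  calc |g₁ x| = |g₁ x| * δ / δ := by field_simp
    _ ≤ (2 * B₀ + B₂ * δ ^ 2) / δ := by gcongr
    _ = _ := by field_simp

end Taylor

section Extrema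

/-- The derivative at a right end point maximum is nonnegative. -/
lemma deriv_nonneg_of_le_left {φ : ℝ → ℝ} {a t d : ℝ} (hat : a < t) (hd : HasDerivAt φ d t)
    (h : ∀ s ∈ Set.Icc a t, φ s ≤ φ t) : 0 ≤ d := by
  have ht := (hasDerivWithinAt_iff_tendsto_slope' (s := Set.Iio t) (by simp)).1
    (hd.hasDerivWithinAt (s := Set.Iio t))
  refine ge_of_tendsto ht ?_
  filter_upwards [Ioo_mem_nhdsLT hat] with s hs
  rw [slope_def_field]
  exact div_nonneg_of_nonpos (by linarith [h s ⟨hs.1.le, hs.2.le⟩]) (by linarith [hs.2])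

/-- The second derivative at a local maximum is nonpositive. -/
lemma second_deriv_nonpos_of_isLocalMax {φ : ℝ → ℝ} {x : ℝ} (hc : ContinuousAt φ x)
    (h : IsLocalMax φ x) : deriv (deriv φ) x ≤ 0 := by
  by_contra hpos
  have hmin := isLocalMin_of_deriv_deriv_pos (not_le.1 hpos) h.deriv_eq_zero hc
  have he : φ =ᶠ[nhds x] fun _ => φ x := by
    filter_upwards [h, hmin] with y h1 h2 using le_antisymm h1 h2
  have : deriv (deriv φ) x = 0 := by
    rw [he.deriv.deriv_eq]; simp
  exact hpos this.le

end Extrema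

/-- The hypotheses on the coupling matrix: smoothness, nonpositive off-diagonal entries and row
sums larger than `α`. -/
structure IsCoupling (s : Finset ℕ) (T α : ℝ) (A : ℕ → ℕ → ℝ → ℝ → ℝ) : Prop where
  smooth : ∀ i ∈ s, ∀ j ∈ s, Smooth2 (A i j)
  off : ∀ i ∈ s, ∀ j ∈ s, i ≠ j →
    ∀ x ∈ Set.Icc (0:ℝ) 1, ∀ t ∈ Set.Icc (0:ℝ) T, A i j x t ≤ 0
  row : ∀ x ∈ Set.Icc (0:ℝ) 1, ∀ t ∈ Set.Icc (0:ℝ) T, ∀ i ∈ s, α < ∑ j ∈ s, A i j x t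

/-- `w` solves the parabolic system with right-hand side `G` on the closed rectangle. -/
def Solves (s : Finset ℕ) (T : ℝ) (ε : ℕ → ℝ) (A : ℕ → ℕ → ℝ → ℝ → ℝ)
    (w G : ℕ → ℝ → ℝ → ℝ) : Prop :=
  ∀ i ∈ s, EqOnRect T
    (fun x t => Dt (w i) x t - ε i * Dx (Dx (w i)) x t + ∑ j ∈ s, A i j x t * w j x t) (G i)

section Stability

variable {s : Finset ℕ} {T α : ℝ} {A : ℕ → ℕ → ℝ → ℝ → ℝ} {ε : ℕ → ℝ} {w G : ℕ → ℝ → ℝ → ℝ}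

lemma IsCoupling.mul_le_sum (hA : IsCoupling s T α A) {x t : ℝ} (hx : x ∈ Set.Icc (0:ℝ) 1)
    (ht : t ∈ Set.Icc (0:ℝ) T) {i : ℕ} (hi : i ∈ s) {c : ℕ → ℝ} (hc0 : 0 ≤ c i)
    (hc : ∀ j ∈ s, c j ≤ c i) : α * c i ≤ ∑ j ∈ s, A i j x t * c j := by
  calc α * c i ≤ (∑ j ∈ s, A i j x t) * c i :=
        mul_le_mul_of_nonneg_right (hA.row x hx t ht i hi).le hc0
    _ = ∑ j ∈ s, A i j x t * c i := Finset.sum_mul ..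
    _ ≤ _ := Finset.sum_le_sum fun j hj => by
      by_cases hij : i = j
      · subst hij; exact le_rfl
      · exact mul_le_mul_of_nonpos_left (hc j hj) (hA.off i hi j hj hij x hx t ht)

/-- One-sided maximum principle. The lateral boundary is only needed for the components with a
positive diffusion coefficient. -/
lemma Solves.le_of_boundary (hα : 0 < α) (hA : IsCoupling s T α A) (hε : ∀ i ∈ s, 0 ≤ ε i)
    (hw : ∀ i ∈ s, Smooth2 (w i)) (hs : Solves s T ε A w G) {K K' : ℝ} (hK : 0 ≤ K) (hK' : 0 ≤ K')
    (hG : ∀ i ∈ s, ∀ x ∈ Set.Icc (0:ℝ) 1, ∀ t ∈ Set.Icc (0:ℝ) T, G i x t ≤ K)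
    (hb : ∀ i ∈ s, ∀ x ∈ Set.Icc (0:ℝ) 1, ∀ t ∈ Set.Icc (0:ℝ) T,
      (t = 0 ∨ ((x = 0 ∨ x = 1) ∧ 0 < ε i)) → w i x t ≤ K') :
    ∀ i ∈ s, ∀ x ∈ Set.Icc (0:ℝ) 1, ∀ t ∈ Set.Icc (0:ℝ) T, w i x t ≤ K / α + K' := by
  intro i hi x hx t ht
  have hmax : ∀ i ∈ s, ∃ q ∈ Set.Icc (0:ℝ) 1 ×ˢ Set.Icc (0:ℝ) T,
      ∀ q' ∈ Set.Icc (0:ℝ) 1 ×ˢ Set.Icc (0:ℝ) T, w i q'.1 q'.2 ≤ w i q.1 q.2 := fun i hi =>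
    (isCompact_Icc.prod isCompact_Icc).exists_isMaxOn ⟨(x, t), hx, ht⟩
      (hw i hi).continuous.continuousOn
  choose! q hq hqmax using hmax
  obtain ⟨m, hm, hmmax⟩ := s.exists_max_image (fun i => w i (q i).1 (q i).2) ⟨i, hi⟩
  have hall : ∀ j ∈ s, ∀ y ∈ Set.Icc (0:ℝ) 1, ∀ r ∈ Set.Icc (0:ℝ) T,
      w j y r ≤ w m (q m).1 (q m).2 :=
    fun j hj y hy r hr => (hqmax j hj (y, r) ⟨hy, hr⟩).trans (hmmax j hj)
  refine (hall i hi x hx t ht).trans ?_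
  obtain ⟨hX, hR⟩ := hq m hm
  set X := (q m).1
  set R := (q m).2
  have hKα : 0 ≤ K / α := div_nonneg hK hα.le
  by_contra hlt
  push Not at hlt
  have hnb : ¬ (R = 0 ∨ ((X = 0 ∨ X = 1) ∧ 0 < ε m)) := fun h => by
    linarith [hb m hm X hX R hR h]
  push Not at hnb
  obtain ⟨hR0, hX0⟩ := hnb
  have hRpos : 0 < R := lt_of_le_of_ne hR.1 (Ne.symm hR0)
  have h1 : 0 ≤ Dt (w m) X R :=
    deriv_nonneg_of_le_left hRpos ((hw m hm).hasDerivAt_Dt X R) fun r hr =>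
      hall m hm X hX r ⟨hr.1, hr.2.trans hR.2⟩
  have h2 : ε m * Dx (Dx (w m)) X R ≤ 0 := by
    rcases (hε m hm).eq_or_lt with h | h
    · simp [← h]
    · have hXi : X ∈ Set.Ioo (0:ℝ) 1 := by
        refine ⟨lt_of_le_of_ne hX.1 fun e => ?_, lt_of_le_of_ne hX.2 fun e => ?_⟩
        · exact absurd h (not_lt.2 (hX0 (Or.inl e.symm)))
        · exact absurd h (not_lt.2 (hX0 (Or.inr e)))
      refine mul_nonpos_of_nonneg_of_nonpos h.le ?_
      refine second_deriv_nonpos_of_isLocalMax (φ := fun y => w m y R)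
        ((hw m hm).continuous_fst R).continuousAt ?_
      filter_upwards [Ioo_mem_nhds hXi.1 hXi.2] with y hy
      exact hall m hm y (Set.Ioo_subset_Icc_self hy) R hR
  have h3 := hA.mul_le_sum hX hR hm (c := fun j => w j X R) (by linarith)
    fun j hj => hall j hj X hX R hR
  have h4 := hs m hm X hX R hR
  have h5 := hG m hm X hX R hR
  have h6 : α * w m X R ≤ K := by
    simp only at h3 h4
    linarith
  have h7 : w m X R ≤ K / α := by rw [le_div_iff₀ hα]; linarith
  linarith

/-- Stability of the parabolic system in the maximum norm. -/
lemma Solves.bdd (hα : 0 < α) (hA : IsCoupling s T α A) (hε : ∀ i ∈ s, 0 ≤ ε i)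
    (hw : ∀ i ∈ s, Smooth2 (w i)) (hs : Solves s T ε A w G) {K K' : ℝ} (hK : 0 ≤ K) (hK' : 0 ≤ K')
    (hG : ∀ i ∈ s, BddOnRect T (G i) K)
    (hb : ∀ i ∈ s, ∀ x ∈ Set.Icc (0:ℝ) 1, ∀ t ∈ Set.Icc (0:ℝ) T,
      (t = 0 ∨ ((x = 0 ∨ x = 1) ∧ 0 < ε i)) → |w i x t| ≤ K') :
    ∀ i ∈ s, BddOnRect T (w i) (K / α + K') := by
  intro i hi x hx t ht
  have hDx : ∀ g : ℝ → ℝ → ℝ, Dx (fun x t => -g x t) = fun x t => -Dx g x t := fun g => by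
    ext x t; exact deriv.fun_neg
  have hDt : ∀ g : ℝ → ℝ → ℝ, Dt (fun x t => -g x t) = fun x t => -Dt g x t := fun g => by
    ext x t; exact deriv.fun_neg
  have hneg : Solves s T ε A (fun i x t => -w i x t) (fun i x t => -G i x t) := by
    intro i hi x hx t ht
    simp only [hDx, hDt]
    rw [← hs i hi x hx t ht]
    simp only [mul_neg, Finset.sum_neg_distrib]
    ring
  refine abs_le'.2 ⟨hs.le_of_boundary hα hA hε hw hK hK'
    (fun i hi x hx t ht => (abs_le'.1 (hG i hi x hx t ht)).1)
    (fun i hi x hx t ht h => (abs_le'.1 (hb i hi x hx t ht h)).1) i hi x hx t ht, ?_⟩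
  exact hneg.le_of_boundary hα hA hε (w := fun i x t => -w i x t)
    (fun i hi => ContDiff.neg (hw i hi)) hK hK'
    (fun i hi x hx t ht => (abs_le'.1 (hG i hi x hx t ht)).2)
    (fun i hi x hx t ht h => (abs_le'.1 (hb i hi x hx t ht h)).2) i hi x hx t ht

lemma smooth_lhs (hA : IsCoupling s T α A) (hw : ∀ i ∈ s, Smooth2 (w i)) {i : ℕ} (hi : i ∈ s) :
    Smooth2 (fun x t => Dt (w i) x t - ε i * Dx (Dx (w i)) x t
      + ∑ j ∈ s, A i j x t * w j x t) :=
  ((hw i hi).dt.sub ((hw i hi).dx.dx.const_mul (ε i))).add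
    (Smooth2.sum fun j hj => (hA.smooth i hi j hj).mul (hw j hj))

/-- Differentiating the system in `t`. -/
lemma Solves.dt (hT : 0 < T) (hA : IsCoupling s T α A) (hw : ∀ i ∈ s, Smooth2 (w i))
    (hG : ∀ i ∈ s, Smooth2 (G i)) (hs : Solves s T ε A w G) :
    Solves s T ε A (fun i => Dt (w i))
      (fun i x t => Dt (G i) x t - ∑ j ∈ s, Dt (A i j) x t * w j x t) := by
  intro i hi x hx t ht
  have h := (hs i hi).dt hT (smooth_lhs hA hw hi) (hG i hi) x hx t ht
  have hAw : ∀ j ∈ s, Smooth2 fun x t => A i j x t * w j x t :=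
    fun j hj => (hA.smooth i hi j hj).mul (hw j hj)
  rw [Dt_add ((hw i hi).dt.sub ((hw i hi).dx.dx.const_mul (ε i))) (Smooth2.sum hAw),
    Dt_sub (hw i hi).dt ((hw i hi).dx.dx.const_mul (ε i)), Dt_const_mul _ (hw i hi).dx.dx,
    Dt_sum hAw, ← (hw i hi).dx.Dx_Dt_comm, ← (hw i hi).Dx_Dt_comm] at h
  have hsum : ∑ j ∈ s, Dt (fun x t => A i j x t * w j x t) x t
      = ∑ j ∈ s, Dt (A i j) x t * w j x t + ∑ j ∈ s, A i j x t * Dt (w j) x t := by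
    rw [← Finset.sum_add_distrib]
    exact Finset.sum_congr rfl fun j hj => by rw [Dt_mul (hA.smooth i hi j hj) (hw j hj)]
  simp only [hsum] at h
  linarith

/-- Differentiating the system in `x`. -/
lemma Solves.dx (hA : IsCoupling s T α A) (hw : ∀ i ∈ s, Smooth2 (w i))
    (hG : ∀ i ∈ s, Smooth2 (G i)) (hs : Solves s T ε A w G) :
    Solves s T ε A (fun i => Dx (w i))
      (fun i x t => Dx (G i) x t - ∑ j ∈ s, Dx (A i j) x t * w j x t) := by
  intro i hi x hx t ht
  have h := (hs i hi).dx (smooth_lhs hA hw hi) (hG i hi) x hx t ht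
  have hAw : ∀ j ∈ s, Smooth2 fun x t => A i j x t * w j x t :=
    fun j hj => (hA.smooth i hi j hj).mul (hw j hj)
  rw [Dx_add ((hw i hi).dt.sub ((hw i hi).dx.dx.const_mul (ε i))) (Smooth2.sum hAw),
    Dx_sub (hw i hi).dt ((hw i hi).dx.dx.const_mul (ε i)), Dx_const_mul _ (hw i hi).dx.dx,
    Dx_sum hAw, (hw i hi).Dx_Dt_comm] at h
  have hsum : ∑ j ∈ s, Dx (fun x t => A i j x t * w j x t) x t
      = ∑ j ∈ s, Dx (A i j) x t * w j x t + ∑ j ∈ s, A i j x t * Dx (w j) x t := by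
    rw [← Finset.sum_add_distrib]
    exact Finset.sum_congr rfl fun j hj => by rw [Dx_mul (hA.smooth i hi j hj) (hw j hj)]
  simp only [hsum] at h
  linarith

end Stability

section APriori

variable {s : Finset ℕ} {T α : ℝ} {A : ℕ → ℕ → ℝ → ℝ → ℝ}

lemma abs_sum_mul_le {P Q : ℕ → ℝ} {p q : ℝ} (hP : ∀ j ∈ s, |P j| ≤ p) (hQ : ∀ j ∈ s, |Q j| ≤ q) :
    |∑ j ∈ s, P j * Q j| ≤ s.card * (p * q) := by
  calc |∑ j ∈ s, P j * Q j| ≤ ∑ j ∈ s, |P j * Q j| := Finset.abs_sum_le_sum_abs _ _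
    _ ≤ ∑ _j ∈ s, p * q := Finset.sum_le_sum fun j hj => by
      rw [abs_mul]
      exact mul_le_mul (hP j hj) (hQ j hj) (abs_nonneg _) ((abs_nonneg _).trans (hP j hj))
    _ = _ := by rw [Finset.sum_const, nsmul_eq_mul]

lemma Dx_sum_mul {P Q : ℕ → ℝ → ℝ → ℝ} (hP : ∀ j ∈ s, Smooth2 (P j)) (hQ : ∀ j ∈ s, Smooth2 (Q j)) :
    Dx (fun x t => ∑ j ∈ s, P j x t * Q j x t)
      = fun x t => ∑ j ∈ s, Dx (P j) x t * Q j x t + ∑ j ∈ s, P j x t * Dx (Q j) x t := by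
  rw [Dx_sum fun j hj => (hP j hj).mul (hQ j hj)]
  ext x t
  rw [← Finset.sum_add_distrib]
  exact Finset.sum_congr rfl fun j hj => by rw [Dx_mul (hP j hj) (hQ j hj)]

lemma Smooth2.sum_mul {P Q : ℕ → ℝ → ℝ → ℝ} (hP : ∀ j ∈ s, Smooth2 (P j))
    (hQ : ∀ j ∈ s, Smooth2 (Q j)) : Smooth2 fun x t => ∑ j ∈ s, P j x t * Q j x t :=
  Smooth2.sum fun j hj => (hP j hj).mul (hQ j hj)

lemma Dx_Dx_sum_mul {P Q : ℕ → ℝ → ℝ → ℝ} (hP : ∀ j ∈ s, Smooth2 (P j))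
    (hQ : ∀ j ∈ s, Smooth2 (Q j)) :
    Dx (Dx (fun x t => ∑ j ∈ s, P j x t * Q j x t))
      = fun x t => ∑ j ∈ s, Dx (Dx (P j)) x t * Q j x t
        + 2 * ∑ j ∈ s, Dx (P j) x t * Dx (Q j) x t + ∑ j ∈ s, P j x t * Dx (Dx (Q j)) x t := by
  have hP' : ∀ j ∈ s, Smooth2 (Dx (P j)) := fun j hj => (hP j hj).dx
  have hQ' : ∀ j ∈ s, Smooth2 (Dx (Q j)) := fun j hj => (hQ j hj).dx
  rw [Dx_sum_mul hP hQ, Dx_add (Smooth2.sum_mul hP' hQ) (Smooth2.sum_mul hP hQ'),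
    Dx_sum_mul hP' hQ, Dx_sum_mul hP hQ']
  ext x t
  ring

/-- Differentiating the system twice in `x`. -/
lemma Solves.dxx {ε : ℕ → ℝ} {w G : ℕ → ℝ → ℝ → ℝ} (hA : IsCoupling s T α A)
    (hw : ∀ i ∈ s, Smooth2 (w i)) (hG : ∀ i ∈ s, Smooth2 (G i)) (hs : Solves s T ε A w G) :
    Solves s T ε A (fun i => Dx (Dx (w i)))
      (fun i x t => Dx (Dx (G i)) x t - ∑ j ∈ s, Dx (Dx (A i j)) x t * w j x t
        - 2 * ∑ j ∈ s, Dx (A i j) x t * Dx (w j) x t) := by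
  have hAx : ∀ i ∈ s, ∀ j ∈ s, Smooth2 (Dx (A i j)) := fun i hi j hj => (hA.smooth i hi j hj).dx
  have h := (hs.dx hA hw hG).dx hA (fun i hi => (hw i hi).dx)
    fun i hi => (hG i hi).dx.sub (Smooth2.sum_mul (hAx i hi) hw)
  intro i hi x hx t ht
  rw [h i hi x hx t ht]
  simp only
  rw [Dx_sub (hG i hi).dx (Smooth2.sum_mul (hAx i hi) hw),
    Dx_sum_mul (hAx i hi) hw]
  ring

/-- Absorption: an a priori bound that loses half of itself gives a bound. -/
lemma bdd_of_absorb {h : ℕ → ℝ → ℝ → ℝ} (hh : ∀ i ∈ s, Smooth2 (h i)) {P : ℝ} (hP : 0 ≤ P)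
    (hab : ∀ Z, 0 ≤ Z → (∀ i ∈ s, BddOnRect T (h i) Z) → ∀ i ∈ s, BddOnRect T (h i) (P + Z / 2)) :
    ∀ i ∈ s, BddOnRect T (h i) (2 * P) := by
  set S : Set ℝ := {Z | 0 ≤ Z ∧ ∀ i ∈ s, BddOnRect T (h i) Z}
  have hne : S.Nonempty := Smooth2.exists_bdd_family T hh
  have hbdd : BddBelow S := ⟨0, fun Z hZ => hZ.1⟩
  have hmem : sInf S ∈ S :=
    ⟨le_csInf hne fun Z hZ => hZ.1,
      fun i hi x hx t ht => le_csInf hne fun Z hZ => hZ.2 i hi x hx t ht⟩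
  have hle : sInf S ≤ P + sInf S / 2 :=
    csInf_le hbdd ⟨by linarith [hmem.1], hab _ hmem.1 hmem.2⟩
  intro i hi x hx t ht
  exact (hmem.2 i hi x hx t ht).trans (by linarith)

lemma bdd_Dx_of_bdd {g : ℝ → ℝ → ℝ} (hg : Smooth2 g) {B₀ B₂ δ : ℝ} (hδ : 0 < δ) (hδ' : δ ≤ 1 / 2)
    (h0 : BddOnRect T g B₀) (h2 : BddOnRect T (Dx (Dx g)) B₂) :
    BddOnRect T (Dx g) (2 * B₀ / δ + B₂ * δ) :=
  fun _ hx t ht => abs_deriv_le_interpolation hδ hδ' (fun z => hg.hasDerivAt_Dx z t)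
    (fun z => hg.dx.hasDerivAt_Dx z t) (fun z hz => h0 z hz t ht) (fun z hz => h2 z hz t ht) hx

/-- A bound on the second space derivatives, uniform in the diffusion coefficients. -/
lemma exists_bdd_Dx_Dx (hα : 0 < α) (hA : IsCoupling s T α A) {W G₂ Z₀ : ℝ} (hW : 0 ≤ W)
    (hG₂ : 0 ≤ G₂) (hZ₀ : 0 ≤ Z₀) :
    ∃ C, 0 ≤ C ∧ ∀ (ε : ℕ → ℝ) (w G : ℕ → ℝ → ℝ → ℝ), (∀ i ∈ s, 0 ≤ ε i) →
      (∀ i ∈ s, Smooth2 (w i)) → (∀ i ∈ s, Smooth2 (G i)) → Solves s T ε A w G →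
      (∀ i ∈ s, BddOnRect T (w i) W) → (∀ i ∈ s, BddOnRect T (Dx (Dx (G i))) G₂) →
      (∀ i ∈ s, ∀ x ∈ Set.Icc (0:ℝ) 1, ∀ t ∈ Set.Icc (0:ℝ) T,
        (t = 0 ∨ x = 0 ∨ x = 1) → |Dx (Dx (w i)) x t| ≤ Z₀) →
      ∀ i ∈ s, BddOnRect T (Dx (Dx (w i))) C := by
  obtain ⟨a₁, ha₁, hA₁⟩ := Smooth2.exists_bdd_family₂ T (g := fun i j => Dx (A i j))
    fun i hi j hj => (hA.smooth i hi j hj).dx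
  obtain ⟨a₂, ha₂, hA₂⟩ := Smooth2.exists_bdd_family₂ T (g := fun i j => Dx (Dx (A i j)))
    fun i hi j hj => (hA.smooth i hi j hj).dx.dx
  set c : ℝ := (s.card : ℝ)
  have hc : 0 ≤ c := Nat.cast_nonneg _
  obtain ⟨δ, hδ, hδ', hδα⟩ : ∃ δ : ℝ, 0 < δ ∧ δ ≤ 1 / 2 ∧ 4 * c * a₁ * δ ≤ α := by
    have hpos : 0 < 4 * c * a₁ + 1 := by positivity
    refine ⟨min (1 / 2) (α / (4 * c * a₁ + 1)), by positivity, min_le_left _ _, ?_⟩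
    calc 4 * c * a₁ * min (1 / 2) (α / (4 * c * a₁ + 1))
        ≤ (4 * c * a₁ + 1) * (α / (4 * c * a₁ + 1)) :=
          mul_le_mul (by linarith) (min_le_right _ _) (by positivity) hpos.le
      _ = α := by field_simp
  set P : ℝ := (G₂ + c * (a₂ * W) + 2 * (c * (a₁ * (2 * W / δ)))) / α + Z₀
  have hP : 0 ≤ P := by positivity
  refine ⟨2 * P, by positivity, fun ε w G hε hw hG hs hWb hGb hb => ?_⟩
  refine bdd_of_absorb (fun i hi => (hw i hi).dx.dx) hP fun Z hZ hZb => ?_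
  have hW₁ : ∀ i ∈ s, BddOnRect T (Dx (w i)) (2 * W / δ + Z * δ) := fun i hi =>
    bdd_Dx_of_bdd (hw i hi) hδ hδ' (hWb i hi) (hZb i hi)
  have h := (hs.dxx hA hw hG).bdd hα hA hε (fun i hi => (hw i hi).dx.dx)
    (K := G₂ + c * (a₂ * W) + 2 * (c * (a₁ * (2 * W / δ + Z * δ)))) (by positivity) hZ₀
    (fun i hi x hx t ht => ?_)
    (fun i hi x hx t ht h => hb i hi x hx t ht (h.imp_right And.left))
  · intro i hi x hx t ht
    refine (h i hi x hx t ht).trans ?_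
    have : 2 * (c * (a₁ * (Z * δ))) / α ≤ Z / 2 := by
      rw [div_le_iff₀ hα]
      nlinarith
    calc _ = P + 2 * (c * (a₁ * (Z * δ))) / α := by simp only [P]; ring
      _ ≤ _ := by linarith
  · have e1 := abs_le.1 (hGb i hi x hx t ht)
    have e2 := abs_le.1 (abs_sum_mul_le (fun j hj => hA₂ i hi j hj x hx t ht)
      (fun j hj => hWb j hj x hx t ht))
    have e3 := abs_le.1 (abs_sum_mul_le (fun j hj => hA₁ i hi j hj x hx t ht)
      (fun j hj => hW₁ j hj x hx t ht))
    exact abs_le.2 ⟨by linarith [e1.1, e2.2, e3.2], by linarith [e1.2, e2.1, e3.1]⟩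

/-- Bounds on the derivatives of the smooth component, uniform in the diffusion coefficients. -/
lemma exists_smooth_component_bounds (hT : 0 < T) (hα : 0 < α) (hA : IsCoupling s T α A)
    {f φ : ℕ → ℝ → ℝ → ℝ} (hf : ∀ i ∈ s, Smooth2 (f i)) (hφ : ∀ i ∈ s, Smooth2 (φ i)) :
    ∃ C, 0 < C ∧ ∀ (ε : ℕ → ℝ) (u v : ℕ → ℝ → ℝ → ℝ),
      (∀ i ∈ s, 0 < ε i) → (∀ i ∈ s, ε i ≤ 1) →
      (∀ i ∈ s, Smooth2 (u i)) → (∀ i ∈ s, Smooth2 (v i)) →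
      Solves s T (fun _ => 0) A u f →
      (∀ i ∈ s, ∀ x ∈ Set.Icc (0:ℝ) 1, u i x 0 = φ i x 0) →
      Solves s T ε A v f →
      (∀ i ∈ s, ∀ x ∈ Set.Icc (0:ℝ) 1, ∀ t ∈ Set.Icc (0:ℝ) T,
        (x = 0 ∨ x = 1 ∨ t = 0) → v i x t = u i x t) →
      ∀ i ∈ s, BddOnRect T (Dt (Dt (v i))) C ∧ BddOnRect T (Dx (Dx (v i))) C ∧
        BddOnRect T (Dx (Dx (Dx (v i)))) (C / √(ε i)) ∧
        BddOnRect T (Dx (Dx (Dx (Dx (v i))))) (C / ε i) := by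
  obtain ⟨a, ha, hAb⟩ := Smooth2.exists_bdd_family₂ T (g := A) hA.smooth
  obtain ⟨a₁, ha₁, hA₁⟩ := Smooth2.exists_bdd_family₂ T (g := fun i j => Dx (A i j))
    fun i hi j hj => (hA.smooth i hi j hj).dx
  obtain ⟨a₂, ha₂, hA₂⟩ := Smooth2.exists_bdd_family₂ T (g := fun i j => Dx (Dx (A i j)))
    fun i hi j hj => (hA.smooth i hi j hj).dx.dx
  obtain ⟨b, hb, hB⟩ := Smooth2.exists_bdd_family₂ T (g := fun i j => Dt (A i j))
    fun i hi j hj => (hA.smooth i hi j hj).dt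
  obtain ⟨b₁, hb₁, hB₁⟩ := Smooth2.exists_bdd_family₂ T (g := fun i j => Dx (Dt (A i j)))
    fun i hi j hj => (hA.smooth i hi j hj).dt.dx
  obtain ⟨b₂, hb₂, hB₂⟩ := Smooth2.exists_bdd_family₂ T (g := fun i j => Dx (Dx (Dt (A i j))))
    fun i hi j hj => (hA.smooth i hi j hj).dt.dx.dx
  obtain ⟨k, hk, hkf⟩ := Smooth2.exists_bdd_family T hf
  obtain ⟨k₂, hk₂, hkf₂⟩ := Smooth2.exists_bdd_family T (g := fun i => Dx (Dx (f i)))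
    fun i hi => (hf i hi).dx.dx
  obtain ⟨l, hl, hlf⟩ := Smooth2.exists_bdd_family T (g := fun i => Dt (f i))
    fun i hi => (hf i hi).dt
  obtain ⟨l₂, hl₂, hlf₂⟩ := Smooth2.exists_bdd_family T (g := fun i => Dx (Dx (Dt (f i))))
    fun i hi => (hf i hi).dt.dx.dx
  obtain ⟨m, hm, hmφ⟩ := Smooth2.exists_bdd_family T hφ
  obtain ⟨m₂, hm₂, hmφ₂⟩ := Smooth2.exists_bdd_family T (g := fun i => Dx (Dx (φ i)))
    fun i hi => (hφ i hi).dx.dx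
  obtain ⟨m₄, hm₄, hmφ₄⟩ := Smooth2.exists_bdd_family T (g := fun i => Dx (Dx (Dx (Dx (φ i)))))
    fun i hi => (hφ i hi).dx.dx.dx.dx
  set c : ℝ := (s.card : ℝ)
  have hc : 0 ≤ c := Nat.cast_nonneg _
  set V₀ : ℝ := k / α + (k / α + m)
  have hV₀ : 0 ≤ V₀ := by positivity
  obtain ⟨V₂, hV₂, hbV₂⟩ := exists_bdd_Dx_Dx hα hA hV₀ hk₂ hm₂
  set V₁ : ℝ := 2 * V₀ / (1 / 2) + V₂ * (1 / 2)
  have hV₁ : 0 ≤ V₁ := by positivity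
  set Vt : ℝ := k + c * (a * V₀) + V₂
  have hVt : 0 ≤ Vt := by positivity
  set H : ℝ := k₂ + c * (a₂ * V₀) + 2 * (c * (a₁ * V₁))
  have hH : 0 ≤ H := by positivity
  obtain ⟨Vtx, hVtx, hbVtx⟩ := exists_bdd_Dx_Dx hα hA hVt
    (G₂ := l₂ + (c * (b₂ * V₀) + 2 * (c * (b₁ * V₁)) + c * (b * V₂))) (by positivity)
    (Z₀ := H + c * (a * V₂) + m₄) (by positivity)
  set Vtt : ℝ := l + c * (b * V₀) + c * (a * Vt) + Vtx
  have hVtt : 0 ≤ Vtt := by positivity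
  set V₄ : ℝ := Vtx + c * (a * V₂) + H
  have hV₄ : 0 ≤ V₄ := by positivity
  refine ⟨1 + Vtt + 4 * V₂ + V₄, by positivity,
    fun ε u v hε hε1 hu hv hsu hu0 hsv hvu => ?_⟩
  have h00 : (0:ℝ) ∈ Set.Icc 0 T := ⟨le_rfl, hT.le⟩
  have hε0 : ∀ i ∈ s, 0 ≤ ε i := fun i hi => (hε i hi).le
  have bu : ∀ i ∈ s, BddOnRect T (u i) (k / α + m) :=
    hsu.bdd hα hA (fun _ _ => le_rfl) hu hk hm hkf fun i hi x hx t ht h => by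
      rcases h with rfl | h
      · rw [hu0 i hi x hx]; exact hmφ i hi x hx 0 ht
      · exact absurd h.2 (lt_irrefl _)
  have bv : ∀ i ∈ s, BddOnRect T (v i) V₀ :=
    hsv.bdd hα hA hε0 hv hk (by positivity) hkf fun i hi x hx t ht h => by
      rw [hvu i hi x hx t ht (by tauto)]; exact bu i hi x hx t ht
  have hv0 : ∀ i ∈ s, ∀ x ∈ Set.Icc (0:ℝ) 1, v i x 0 = φ i x 0 := fun i hi x hx => by
    rw [hvu i hi x hx 0 h00 (by simp), hu0 i hi x hx]
  have hv2 : ∀ i ∈ s, ∀ x ∈ Set.Icc (0:ℝ) 1, Dx (Dx (v i)) x 0 = Dx (Dx (φ i)) x 0 :=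
    fun i hi => Dx_eq_of_eq (hv i hi).dx (hφ i hi).dx
      (Dx_eq_of_eq (hv i hi) (hφ i hi) (hv0 i hi))
  have hv4 : ∀ i ∈ s, ∀ x ∈ Set.Icc (0:ℝ) 1,
      Dx (Dx (Dx (Dx (v i)))) x 0 = Dx (Dx (Dx (Dx (φ i)))) x 0 :=
    fun i hi => Dx_eq_of_eq (hv i hi).dx.dx.dx (hφ i hi).dx.dx.dx
      (Dx_eq_of_eq (hv i hi).dx.dx (hφ i hi).dx.dx (hv2 i hi))
  have hlat : ∀ i ∈ s, ∀ x ∈ Set.Icc (0:ℝ) 1, (x = 0 ∨ x = 1) → ∀ t ∈ Set.Icc (0:ℝ) T,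
      Dx (Dx (v i)) x t = 0 := by
    intro i hi x hx hx01 t ht
    have e1 := hsv i hi x hx t ht
    have e2 := hsu i hi x hx t ht
    have e3 := Dt_eq_of_eq hT (hv i hi) (hu i hi)
      (fun r hr => hvu i hi x hx r hr (by tauto)) t ht
    have e4 : ∑ j ∈ s, A i j x t * v j x t = ∑ j ∈ s, A i j x t * u j x t :=
      Finset.sum_congr rfl fun j hj => by rw [hvu j hj x hx t ht (by tauto)]
    simp only at e1 e2
    have : ε i * Dx (Dx (v i)) x t = 0 := by rw [e3, e4] at e1; linarith
    exact (mul_eq_zero.1 this).resolve_left (hε i hi).ne'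
  have bv2 : ∀ i ∈ s, BddOnRect T (Dx (Dx (v i))) V₂ :=
    hbV₂ ε v f hε0 hv hf hsv bv hkf₂ fun i hi x hx t ht h => by
      rcases h with rfl | h
      · rw [hv2 i hi x hx]; exact hmφ₂ i hi x hx 0 ht
      · rw [hlat i hi x hx h t ht]; simpa using hm₂
  have bv1 : ∀ i ∈ s, BddOnRect T (Dx (v i)) V₁ := fun i hi =>
    bdd_Dx_of_bdd (hv i hi) (by norm_num) le_rfl (bv i hi) (bv2 i hi)
  have bvt : ∀ i ∈ s, BddOnRect T (Dt (v i)) Vt := by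
    intro i hi x hx t ht
    have e0 := hsv i hi x hx t ht
    have e1 := abs_le.1 (hkf i hi x hx t ht)
    have e2 := abs_le.1 (abs_sum_mul_le (fun j hj => hAb i hi j hj x hx t ht)
      (fun j hj => bv j hj x hx t ht))
    have e3 : |ε i * Dx (Dx (v i)) x t| ≤ V₂ := by
      rw [abs_mul, abs_of_pos (hε i hi)]
      exact (mul_le_of_le_one_left (abs_nonneg _) (hε1 i hi)).trans (bv2 i hi x hx t ht)
    have e3 := abs_le.1 e3
    simp only at e0
    exact abs_le.2 ⟨by linarith [e1.1, e2.2, e3.1], by linarith [e1.2, e2.1, e3.2]⟩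
  have hsv2 := hsv.dxx hA hv hf
  have bH : ∀ i ∈ s, BddOnRect T (fun x t => Dx (Dx (f i)) x t
      - ∑ j ∈ s, Dx (Dx (A i j)) x t * v j x t
      - 2 * ∑ j ∈ s, Dx (A i j) x t * Dx (v j) x t) H := by
    intro i hi x hx t ht
    have e1 := abs_le.1 (hkf₂ i hi x hx t ht)
    have e2 := abs_le.1 (abs_sum_mul_le (fun j hj => hA₂ i hi j hj x hx t ht)
      (fun j hj => bv j hj x hx t ht))
    have e3 := abs_le.1 (abs_sum_mul_le (fun j hj => hA₁ i hi j hj x hx t ht)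
      (fun j hj => bv1 j hj x hx t ht))
    exact abs_le.2 ⟨by linarith [e1.1, e2.2, e3.2], by linarith [e1.2, e2.1, e3.1]⟩
  have hcomm : ∀ i ∈ s, Dx (Dx (Dt (v i))) = Dt (Dx (Dx (v i))) := fun i hi => by
    rw [(hv i hi).Dx_Dt_comm, (hv i hi).dx.Dx_Dt_comm]
  have bAv2 : ∀ i ∈ s, BddOnRect T (fun x t => ∑ j ∈ s, A i j x t * Dx (Dx (v j)) x t)
      (c * (a * V₂)) := fun i hi x hx t ht =>
    abs_sum_mul_le (fun j hj => hAb i hi j hj x hx t ht) (fun j hj => bv2 j hj x hx t ht)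
  have hBs : ∀ i ∈ s, ∀ j ∈ s, Smooth2 (Dt (A i j)) := fun i hi j hj => (hA.smooth i hi j hj).dt
  have hsvt := hsv.dt hT hA hv hf
  have bvtx : ∀ i ∈ s, BddOnRect T (Dx (Dx (Dt (v i)))) Vtx := by
    refine hbVtx ε _ _ hε0 (fun i hi => (hv i hi).dt)
      (fun i hi => (hf i hi).dt.sub (Smooth2.sum_mul (hBs i hi) hv)) hsvt bvt ?_ ?_
    · intro i hi x hx t ht
      rw [Dx_sub (hf i hi).dt (Smooth2.sum_mul (hBs i hi) hv),
        Dx_sub (hf i hi).dt.dx (Smooth2.sum_mul (hBs i hi) hv).dx, Dx_Dx_sum_mul (hBs i hi) hv]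
      have e1 := abs_le.1 (hlf₂ i hi x hx t ht)
      have e2 := abs_le.1 (abs_sum_mul_le (fun j hj => hB₂ i hi j hj x hx t ht)
        (fun j hj => bv j hj x hx t ht))
      have e3 := abs_le.1 (abs_sum_mul_le (fun j hj => hB₁ i hi j hj x hx t ht)
        (fun j hj => bv1 j hj x hx t ht))
      have e4 := abs_le.1 (abs_sum_mul_le (fun j hj => hB i hi j hj x hx t ht)
        (fun j hj => bv2 j hj x hx t ht))
      exact abs_le.2 ⟨by linarith [e1.1, e2.2, e3.2, e4.2], by linarith [e1.2, e2.1, e3.1, e4.1]⟩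
    · intro i hi x hx t ht h
      rw [hcomm i hi]
      rcases h with rfl | h
      · have e0 := hsv2 i hi x hx 0 ht
        have e1 := abs_le.1 (bH i hi x hx 0 ht)
        have e2 := abs_le.1 (bAv2 i hi x hx 0 ht)
        have e3 : |ε i * Dx (Dx (Dx (Dx (v i)))) x 0| ≤ m₄ := by
          rw [abs_mul, abs_of_pos (hε i hi), hv4 i hi x hx]
          exact (mul_le_of_le_one_left (abs_nonneg _) (hε1 i hi)).trans (hmφ₄ i hi x hx 0 ht)
        have e3 := abs_le.1 e3
        simp only at e0 e1 e2
        exact abs_le.2 ⟨by linarith [e1.1, e2.2, e3.1], by linarith [e1.2, e2.1, e3.2]⟩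
      · have e := Dt_eq_of_eq (h := fun _ _ => 0) hT (hv i hi).dx.dx contDiff_const
          (fun r hr => hlat i hi x hx h r hr) t ht
        rw [e]
        have : Dt (fun _ _ => (0:ℝ)) x t = 0 := deriv_const _ _
        rw [this, abs_zero]
        positivity
  intro i hi
  have bv4 : BddOnRect T (Dx (Dx (Dx (Dx (v i))))) (V₄ / ε i) := by
    intro x hx t ht
    have e0 := hsv2 i hi x hx t ht
    have e1 := abs_le.1 (bH i hi x hx t ht)
    have e2 := abs_le.1 (bAv2 i hi x hx t ht)
    have e3 := bvtx i hi x hx t ht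
    rw [hcomm i hi] at e3
    have e3 := abs_le.1 e3
    simp only at e0 e1 e2
    rw [le_div_iff₀ (hε i hi), ← abs_of_pos (hε i hi), ← abs_mul, mul_comm]
    exact abs_le.2 ⟨by linarith [e1.2, e2.1, e3.1], by linarith [e1.1, e2.2, e3.2]⟩
  have hsq : 0 < √(ε i) := Real.sqrt_pos.2 (hε i hi)
  have hsq1 : √(ε i) ≤ 1 := Real.sqrt_le_one.2 (hε1 i hi)
  refine ⟨fun x hx t ht => ?_, fun x hx t ht => ?_, fun x hx t ht => ?_, fun x hx t ht => ?_⟩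
  · have e0 := hsvt i hi x hx t ht
    have e1 := abs_le.1 (hlf i hi x hx t ht)
    have e2 := abs_le.1 (abs_sum_mul_le (fun j hj => hB i hi j hj x hx t ht)
      (fun j hj => bv j hj x hx t ht))
    have e4 := abs_le.1 (abs_sum_mul_le (fun j hj => hAb i hi j hj x hx t ht)
      (fun j hj => bvt j hj x hx t ht))
    have e3 : |ε i * Dx (Dx (Dt (v i))) x t| ≤ Vtx := by
      rw [abs_mul, abs_of_pos (hε i hi)]
      exact (mul_le_of_le_one_left (abs_nonneg _) (hε1 i hi)).trans (bvtx i hi x hx t ht)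
    have e3 := abs_le.1 e3
    simp only at e0
    have : |Dt (Dt (v i)) x t| ≤ Vtt :=
      abs_le.2 ⟨by linarith [e1.1, e2.2, e3.1, e4.2], by linarith [e1.2, e2.1, e3.2, e4.1]⟩
    linarith
  · linarith [bv2 i hi x hx t ht]
  · have h3 := bdd_Dx_of_bdd (hv i hi).dx.dx (half_pos hsq) (by linarith) (bv2 i hi) bv4 x hx t ht
    refine h3.trans ?_
    have e : 2 * V₂ / (√(ε i) / 2) + V₄ / ε i * (√(ε i) / 2) = (4 * V₂ + V₄ / 2) / √(ε i) := by
      have : ε i = √(ε i) * √(ε i) := (Real.mul_self_sqrt (hε0 i hi)).symm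
      nth_rewrite 2 [this]
      field_simp
      ring
    rw [e]
    exact div_le_div_of_nonneg_right (by linarith) hsq.le
  · refine (bv4 x hx t ht).trans ?_
    have := hε i hi
    gcongr
    linarith

end APriori

section SecondDifference

/-- The second difference quotient on a nonuniform mesh. -/
noncomputable def secondDiff (x ψ : ℕ → ℝ) (j : ℕ) : ℝ :=
  ((ψ (j + 1) - ψ j) / (x (j + 1) - x j) - (ψ j - ψ (j - 1)) / (x j - x (j - 1)))
    / ((x (j + 1) - x (j - 1)) / 2)

variable {x ψ : ℕ → ℝ} {j : ℕ}

lemma secondDiff_sum (P : Finset ℕ) (θ : ℕ → ℕ → ℝ) :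
    secondDiff x (fun j => ∑ m ∈ P, θ m j) j = ∑ m ∈ P, secondDiff x (θ m) j := by
  simp only [secondDiff, Finset.sum_div, ← Finset.sum_sub_distrib]

/-- A one-sided quadratic bound on the mesh function bounds its second difference. -/
lemma secondDiff_le {d κ : ℝ} (h₁ : x j < x (j + 1)) (h₂ : x (j - 1) < x j)
    (hr : ψ (j + 1) ≤ ψ j + d * (x (j + 1) - x j) + κ * (x (j + 1) - x j) ^ 2)
    (hl : ψ (j - 1) ≤ ψ j + d * (x (j - 1) - x j) + κ * (x (j - 1) - x j) ^ 2) :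
    secondDiff x ψ j ≤ 2 * κ := by
  unfold secondDiff
  have h1 : (ψ (j + 1) - ψ j) / (x (j + 1) - x j) ≤ d + κ * (x (j + 1) - x j) := by
    rw [div_le_iff₀ (sub_pos.2 h₁)]; linarith
  have h2 : d - κ * (x j - x (j - 1)) ≤ (ψ j - ψ (j - 1)) / (x j - x (j - 1)) := by
    rw [le_div_iff₀ (sub_pos.2 h₂)]; linarith
  rw [div_le_iff₀ (by linarith)]
  linarith

lemma abs_secondDiff_sub_le {d e K : ℝ} (h₁ : x j < x (j + 1)) (h₂ : x (j - 1) < x j)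
    (hr : |ψ (j + 1) - ψ j - d * (x (j + 1) - x j) - e * (x (j + 1) - x j) ^ 2 / 2|
      ≤ K * (x (j + 1) - x j) ^ 2)
    (hl : |ψ (j - 1) - ψ j - d * (x (j - 1) - x j) - e * (x (j - 1) - x j) ^ 2 / 2|
      ≤ K * (x (j - 1) - x j) ^ 2) :
    |secondDiff x ψ j - e| ≤ 2 * K := by
  rw [abs_le] at hr hl
  have hu := secondDiff_le (ψ := ψ) (d := d) (κ := e / 2 + K) h₁ h₂ (by linarith [hr.2])
    (by linarith [hl.2])
  have hd := secondDiff_le (ψ := fun j => -ψ j) (d := -d) (κ := -e / 2 + K) h₁ h₂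
    (by linarith [hr.1]) (by linarith [hl.1])
  have hneg : secondDiff x (fun j => -ψ j) j = -secondDiff x ψ j := by
    unfold secondDiff; ring
  rw [hneg] at hd
  exact abs_le.2 ⟨by linarith, by linarith⟩

section Consistency

variable {g g₁ g₂ g₃ g₄ : ℝ → ℝ} {H : ℝ}

/-- Consistency of the second difference on an arbitrary mesh. -/
lemma abs_secondDiff_sub_deriv_le {B₂ B₃ : ℝ} (h0 : ∀ z, HasDerivAt g (g₁ z) z)
    (h1 : ∀ z, HasDerivAt g₁ (g₂ z) z) (h2 : ∀ z, HasDerivAt g₂ (g₃ z) z)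
    (hB₂ : ∀ z ∈ Set.Icc (0:ℝ) 1, |g₂ z| ≤ B₂) (hB₃ : ∀ z ∈ Set.Icc (0:ℝ) 1, |g₃ z| ≤ B₃)
    (m₁ : x (j - 1) ∈ Set.Icc (0:ℝ) 1) (m₂ : x j ∈ Set.Icc (0:ℝ) 1)
    (m₃ : x (j + 1) ∈ Set.Icc (0:ℝ) 1) (h₁ : x j < x (j + 1)) (h₂ : x (j - 1) < x j)
    (H₁ : x (j + 1) - x j ≤ H) (H₂ : x j - x (j - 1) ≤ H) :
    |secondDiff x (fun j => g (x j)) j - g₂ (x j)| ≤ 3 * B₂ ∧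
      |secondDiff x (fun j => g (x j)) j - g₂ (x j)| ≤ 2 * (B₃ * H) := by
  have hB₃0 : 0 ≤ B₃ := (abs_nonneg _).trans (hB₃ _ m₂)
  have hT₁ : ∀ y ∈ Set.Icc (0:ℝ) 1, |g y - g (x j) - g₁ (x j) * (y - x j)
      - 0 * (y - x j) ^ 2 / 2| ≤ B₂ * (y - x j) ^ 2 := fun y hy => by
    have := taylor_one h0 h1 fun z hz => hB₂ z (Set.uIcc_subset_Icc m₂ hy hz)
    rw [sq_abs] at this
    simpa using this
  have hT₂ : ∀ y ∈ Set.Icc (0:ℝ) 1, |y - x j| ≤ H → |g y - g (x j) - g₁ (x j) * (y - x j)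
      - g₂ (x j) * (y - x j) ^ 2 / 2| ≤ B₃ * H * (y - x j) ^ 2 := fun y hy hyH => by
    refine (taylor_two h0 h1 h2 fun z hz => hB₃ z (Set.uIcc_subset_Icc m₂ hy hz)).trans ?_
    rw [pow_succ, sq_abs]
    have := mul_le_mul_of_nonneg_left hyH (mul_nonneg hB₃0 (sq_nonneg (y - x j)))
    linarith
  constructor
  · have := abs_secondDiff_sub_le (ψ := fun j => g (x j)) h₁ h₂ (hT₁ _ m₃) (hT₁ _ m₁)
    rw [sub_zero] at this
    linarith [abs_sub (secondDiff x (fun j => g (x j)) j) (g₂ (x j)), hB₂ _ m₂]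
  · exact abs_secondDiff_sub_le (ψ := fun j => g (x j)) h₁ h₂
      (hT₂ _ m₃ (abs_le.2 ⟨by linarith, H₁⟩)) (hT₂ _ m₁ (abs_le.2 ⟨by linarith, by linarith⟩))

/-- Consistency of the second difference at a point where the mesh is uniform. -/
lemma abs_secondDiff_sub_deriv_le_of_uniform {B₄ : ℝ} (h0 : ∀ z, HasDerivAt g (g₁ z) z)
    (h1 : ∀ z, HasDerivAt g₁ (g₂ z) z) (h2 : ∀ z, HasDerivAt g₂ (g₃ z) z)
    (h3 : ∀ z, HasDerivAt g₃ (g₄ z) z) (hB₄ : ∀ z ∈ Set.Icc (0:ℝ) 1, |g₄ z| ≤ B₄)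
    (m₁ : x (j - 1) ∈ Set.Icc (0:ℝ) 1) (m₂ : x j ∈ Set.Icc (0:ℝ) 1)
    (m₃ : x (j + 1) ∈ Set.Icc (0:ℝ) 1) (h₁ : x j < x (j + 1)) (h₂ : x (j - 1) < x j)
    (H₁ : x (j + 1) - x j ≤ H) (hu : x (j + 1) - x j = x j - x (j - 1)) :
    |secondDiff x (fun j => g (x j)) j - g₂ (x j)| ≤ 2 * (B₄ * H ^ 2) := by
  have hB₄0 : 0 ≤ B₄ := (abs_nonneg _).trans (hB₄ _ m₂)
  set h := x (j + 1) - x j with hh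
  have hT : ∀ y ∈ Set.Icc (0:ℝ) 1, |y - x j| = h →
      |g y - g (x j) - (g₁ (x j) + g₃ (x j) * h ^ 2 / 6) * (y - x j)
        - g₂ (x j) * (y - x j) ^ 2 / 2| ≤ B₄ * H ^ 2 * (y - x j) ^ 2 := fun y hy hyh => by
    have hsq : (y - x j) ^ 2 = h ^ 2 := by rw [← sq_abs, hyh]
    have ht := taylor_three h0 h1 h2 h3 fun z hz => hB₄ z (Set.uIcc_subset_Icc m₂ hy hz)
    calc _ = |g y - g (x j) - g₁ (x j) * (y - x j) - g₂ (x j) * (y - x j) ^ 2 / 2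
          - g₃ (x j) * (y - x j) ^ 3 / 6| := by
            rw [← hsq]; congr 1; ring
      _ ≤ _ := ht
      _ = B₄ * h ^ 2 * (y - x j) ^ 2 := by rw [hyh, hsq]; ring
      _ ≤ _ := by
        have : 0 < h := sub_pos.2 h₁
        gcongr
  exact abs_secondDiff_sub_le (ψ := fun j => g (x j)) h₁ h₂
    (hT _ m₃ (abs_of_pos (sub_pos.2 h₁)))
    (hT _ m₁ (by rw [abs_sub_comm, abs_of_pos (sub_pos.2 h₂), hu]))

end Consistency

/-- The compactly supported barrier profile `max(0, 1 - |z|)²` with a kink at the origin. -/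
noncomputable def kink (z : ℝ) : ℝ := max 0 (1 - |z|) ^ 2

lemma kink_nonneg (z : ℝ) : 0 ≤ kink z := sq_nonneg _

lemma kink_le_one (z : ℝ) : kink z ≤ 1 :=
  pow_le_one₀ (le_max_left _ _) (max_le zero_le_one (by linarith [abs_nonneg z]))

lemma kink_zero : kink 0 = 1 := by simp [kink]

lemma min_le_one_sub_kink (z : ℝ) : min |z| 1 ≤ 1 - kink z := by
  unfold kink
  rcases le_total |z| 1 with h | h
  · rw [max_eq_right (by linarith), min_eq_left h]
    nlinarith [abs_nonneg z]
  · rw [max_eq_left (by linarith), min_eq_right h]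
    norm_num

/-- The profile has a one-sided quadratic bound at every point. -/
lemma exists_kink_le (z₀ : ℝ) :
    ∃ d, ∀ z, kink z ≤ kink z₀ + d * (z - z₀) + (z - z₀) ^ 2 := by
  wlog h : 0 ≤ z₀ generalizing z₀
  · obtain ⟨d, hd⟩ := this (-z₀) (by linarith)
    have hneg : ∀ z, kink (-z) = kink z := fun z => by simp [kink]
    refine ⟨-d, fun z => ?_⟩
    have := hd (-z)
    rw [hneg, hneg] at this
    linarith
  refine ⟨-2 * max 0 (1 - |z₀|), fun z => ?_⟩
  have hsq : kink z₀ + -2 * max 0 (1 - |z₀|) * (z - z₀) + (z - z₀) ^ 2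
      = (max 0 (1 - |z₀|) - (z - z₀)) ^ 2 := by unfold kink; ring
  rw [hsq, kink]
  rw [abs_of_nonneg h]
  have hz := le_abs_self z
  rcases le_total (1 - |z|) 0 with h1 | h1
  · rw [max_eq_left h1]; simpa using sq_nonneg _
  · rw [max_eq_right h1]
    have : 1 - |z| ≤ max 0 (1 - z₀) - (z - z₀) := by
      linarith [le_max_right 0 (1 - z₀)]
    exact pow_le_pow_left₀ h1 this 2

lemma secondDiff_kink_le {ε c : ℝ} (hε : 0 < ε) (h₁ : x j < x (j + 1)) (h₂ : x (j - 1) < x j) :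
    secondDiff x (fun j => kink ((x j - c) / √ε)) j ≤ 2 * (1 / ε) := by
  obtain ⟨d, hd⟩ := exists_kink_le ((x j - c) / √ε)
  have hs : √ε ^ 2 = ε := Real.sq_sqrt hε.le
  have hs0 : 0 < √ε := Real.sqrt_pos.2 hε
  have key : ∀ y, kink ((y - c) / √ε)
      ≤ kink ((x j - c) / √ε) + d / √ε * (y - x j) + 1 / ε * (y - x j) ^ 2 := fun y => by
    refine (hd ((y - c) / √ε)).trans (le_of_eq ?_)
    have hi : 1 / ε = (1 / √ε) ^ 2 := by rw [div_pow, one_pow, hs]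
    rw [hi]
    ring
  exact secondDiff_le h₁ h₂ (key _) (key _)

lemma secondDiff_kink_center_le {ε H : ℝ} (hε : 0 < ε) (h₁ : x j < x (j + 1))
    (h₂ : x (j - 1) < x j) (H₁ : x (j + 1) - x j ≤ H) (H₂ : x j - x (j - 1) ≤ H) :
    secondDiff x (fun i => kink ((x i - x j) / √ε)) j ≤ -(2 * min (1 / √ε) (1 / H) / H) := by
  have hs0 : 0 < √ε := Real.sqrt_pos.2 hε
  have hH : 0 < H := (sub_pos.2 h₁).trans_le H₁
  set μ := min (1 / √ε) (1 / H)
  have hμ : 0 < μ := by positivity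
  have key : ∀ y, 0 < |y - x j| → |y - x j| ≤ H →
      μ * |y - x j| ≤ 1 - kink ((y - x j) / √ε) := fun y hy hyH => by
    refine le_trans ?_ (min_le_one_sub_kink _)
    rw [abs_div, abs_of_pos hs0]
    refine le_min ?_ ?_
    · calc μ * |y - x j| ≤ 1 / √ε * |y - x j| := by gcongr; exact min_le_left _ _
        _ = _ := by ring
    · calc μ * |y - x j| ≤ 1 / H * H := by gcongr; exact min_le_right _ _
        _ = 1 := by field_simp
  have e1 := key (x (j + 1)) (by rw [abs_of_pos] <;> linarith)
    (by rw [abs_of_pos] <;> linarith)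
  have e2 := key (x (j - 1)) (by rw [abs_of_neg] <;> linarith)
    (by rw [abs_of_neg] <;> linarith)
  rw [abs_of_pos (by linarith)] at e1
  rw [abs_of_neg (by linarith)] at e2
  unfold secondDiff
  simp only [sub_self, zero_div, kink_zero]
  have q1 : (kink ((x (j + 1) - x j) / √ε) - 1) / (x (j + 1) - x j) ≤ -μ := by
    rw [div_le_iff₀ (by linarith)]; linarith
  have q2 : μ ≤ (1 - kink ((x (j - 1) - x j) / √ε)) / (x j - x (j - 1)) := by
    rw [le_div_iff₀ (by linarith)]; linarith
  rw [div_le_iff₀ (by linarith)]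
  have : 2 * μ / H * ((x (j + 1) - x (j - 1)) / 2) ≤ 2 * μ / H * H := by
    gcongr; linarith
  have e3 : 2 * μ / H * H = 2 * μ := by field_simp
  linarith

end SecondDifference

section DiscreteComparison

variable {n M N : ℕ} {T α : ℝ} {A : ℕ → ℕ → ℝ → ℝ → ℝ} {ε : ℕ → ℝ} {x t : ℕ → ℝ}

lemma discreteL_eq (Ψ : ℕ → ℕ → ℕ → ℝ) (i j k : ℕ) :
    discreteL n ε A x t Ψ i j k = (Ψ i j k - Ψ i j (k - 1)) / (t k - t (k - 1))
      - ε i * secondDiff x (fun j => Ψ i j k) j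
      + ∑ l ∈ Finset.Icc 1 n, A i l (x j) (t k) * Ψ l j k := rfl

lemma discreteL_add_const_mul (c : ℝ) (Φ Ψ : ℕ → ℕ → ℕ → ℝ) (i j k : ℕ) :
    discreteL n ε A x t (fun i j k => Φ i j k + c * Ψ i j k) i j k
      = discreteL n ε A x t Φ i j k + c * discreteL n ε A x t Ψ i j k := by
  have h : ∑ l ∈ Finset.Icc 1 n, A i l (x j) (t k) * (Φ l j k + c * Ψ l j k)
      = ∑ l ∈ Finset.Icc 1 n, A i l (x j) (t k) * Φ l j k
        + c * ∑ l ∈ Finset.Icc 1 n, A i l (x j) (t k) * Ψ l j k := by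
    rw [Finset.mul_sum, ← Finset.sum_add_distrib]
    exact Finset.sum_congr rfl fun l _ => by ring
  simp only [discreteL, h]
  ring

/-- Discrete maximum principle. -/
lemma nonneg_of_discreteL_nonneg (hα : 0 < α) (hA : IsCoupling (Finset.Icc 1 n) T α A)
    (hε : ∀ i ∈ Finset.Icc 1 n, 0 ≤ ε i)
    (hx : ∀ j ≤ N, x j ∈ Set.Icc (0:ℝ) 1) (hxlt : ∀ j < N, x j < x (j + 1))
    (ht : ∀ k ≤ M, t k ∈ Set.Icc (0:ℝ) T) (htlt : ∀ k < M, t k < t (k + 1))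
    {g : ℕ → ℕ → ℕ → ℝ}
    (hL : ∀ i ∈ Finset.Icc 1 n, ∀ j k, 0 < j → j < N → 0 < k → k ≤ M →
      0 ≤ discreteL n ε A x t g i j k)
    (hb : ∀ i ∈ Finset.Icc 1 n, ∀ j ≤ N, ∀ k ≤ M, (j = 0 ∨ j = N ∨ k = 0) → 0 ≤ g i j k) :
    ∀ i ∈ Finset.Icc 1 n, ∀ j ≤ N, ∀ k ≤ M, 0 ≤ g i j k := by
  intro i hi j hj k hk
  obtain ⟨⟨i', j', k'⟩, hq, hmin⟩ := Finset.exists_min_image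
    (Finset.Icc 1 n ×ˢ Finset.range (N + 1) ×ˢ Finset.range (M + 1))
    (fun q => g q.1 q.2.1 q.2.2)
    ⟨(i, j, k), by simp only [Finset.mem_product, Finset.mem_range]; exact ⟨hi, by lia, by lia⟩⟩
  simp only [Finset.mem_product, Finset.mem_range] at hq
  obtain ⟨hi', hj', hk'⟩ := hq
  have hmin' : ∀ a ∈ Finset.Icc 1 n, ∀ b ≤ N, ∀ c ≤ M, g i' j' k' ≤ g a b c :=
    fun a ha b hb c hc => hmin (a, b, c) (by
      simp only [Finset.mem_product, Finset.mem_range]; exact ⟨ha, by lia, by lia⟩)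
  refine le_trans ?_ (hmin' i hi j hj k hk)
  by_contra hneg
  push Not at hneg
  have hint : ¬(j' = 0 ∨ j' = N ∨ k' = 0) := fun h =>
    absurd (hb i' hi' j' (by lia) k' (by lia) h) (not_le.2 hneg)
  push Not at hint
  obtain ⟨hj0, hjN, hk0⟩ := hint
  have h0 := hL i' hi' j' k' (by lia) (by lia) (by lia) (by lia)
  have hxr := hxlt j' (by lia)
  have hxl := hxlt (j' - 1) (by lia)
  have htl := htlt (k' - 1) (by lia)
  rw [Nat.sub_add_cancel (by lia)] at hxl htl
  rw [discreteL_eq] at h0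
  have h1 : (g i' j' k' - g i' j' (k' - 1)) / (t k' - t (k' - 1)) ≤ 0 :=
    div_nonpos_of_nonpos_of_nonneg
      (by linarith [hmin' i' hi' j' (by lia) (k' - 1) (by lia)]) (by linarith)
  have h2 : 0 ≤ secondDiff x (fun j => g i' j k') j' := by
    have hr := hmin' i' hi' (j' + 1) (by lia) k' (by lia)
    have hl := hmin' i' hi' (j' - 1) (by lia) k' (by lia)
    unfold secondDiff
    refine div_nonneg (sub_nonneg.2 (le_trans ?_ (b := 0) ?_)) (by linarith)
    · exact div_nonpos_of_nonpos_of_nonneg (by linarith) (by linarith)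
    · exact div_nonneg (by linarith) (by linarith)
  have h3 := hA.mul_le_sum (hx j' (by lia)) (ht k' (by lia)) hi' (c := fun l => -g l j' k')
    (by linarith) fun l hl => neg_le_neg (hmin' l hl j' (by lia) k' (by lia))
  simp only [mul_neg, Finset.sum_neg_distrib] at h3
  have h4 := mul_nonneg (hε i' hi') h2
  have h5 := mul_neg_of_pos_of_neg hα hneg
  linarith

end DiscreteComparison

section DiscreteError

variable {n M N : ℕ} {T α : ℝ} {A : ℕ → ℕ → ℝ → ℝ → ℝ} {ε : ℕ → ℝ} {x t : ℕ → ℝ}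

/-- The barrier mesh function: a constant plus kinks of width `√ε_i` centred at the points
of `P`. -/
noncomputable def kinkBarrier (ε : ℕ → ℝ) (x : ℕ → ℝ) (P : Finset ℕ) (K₁ K₂ : ℝ)
    (i j _k : ℕ) : ℝ :=
  K₁ + K₂ * ∑ m ∈ P, kink ((x j - x m) / √(ε i))

lemma sum_kink_nonneg (P : Finset ℕ) (y s : ℝ) : 0 ≤ ∑ m ∈ P, kink ((y - x m) / s) :=
  Finset.sum_nonneg fun _ _ => kink_nonneg _

lemma sum_kink_le (P : Finset ℕ) (y s : ℝ) : ∑ m ∈ P, kink ((y - x m) / s) ≤ P.card := by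
  have := Finset.sum_le_card_nsmul P (fun m => kink ((y - x m) / s)) 1 fun _ _ => kink_le_one _
  simpa using this

lemma le_discreteL_kinkBarrier (hA : IsCoupling (Finset.Icc 1 n) T α A) {a q H K₁ K₂ : ℝ}
    (ha : ∀ i ∈ Finset.Icc 1 n, ∀ l ∈ Finset.Icc 1 n, BddOnRect T (A i l) a)
    {P : Finset ℕ} (hP : (P.card : ℝ) ≤ q) (hK₁ : 0 ≤ K₁) (hK₂ : 0 ≤ K₂)
    {i j k : ℕ} (hi : i ∈ Finset.Icc 1 n) (hε : 0 < ε i)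
    (mx : x j ∈ Set.Icc (0:ℝ) 1) (mt : t k ∈ Set.Icc (0:ℝ) T)
    (h₁ : x j < x (j + 1)) (h₂ : x (j - 1) < x j)
    (H₁ : x (j + 1) - x j ≤ H) (H₂ : x j - x (j - 1) ≤ H) :
    α * K₁ - K₂ * (q * (2 + n * a))
        + (if j ∈ P then K₂ * (ε i * (2 * min (1 / √(ε i)) (1 / H) / H)) else 0)
      ≤ discreteL n ε A x t (kinkBarrier ε x P K₁ K₂) i j k := by
  set μ := 2 * min (1 / √(ε i)) (1 / H) / H with hμ
  have hsd : secondDiff x (fun j => kinkBarrier ε x P K₁ K₂ i j k) j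
      = K₂ * ∑ m ∈ P, secondDiff x (fun j => kink ((x j - x m) / √(ε i))) j := by
    rw [← secondDiff_sum]
    simp only [secondDiff, kinkBarrier]
    ring
  have hterm : ∀ m ∈ P, secondDiff x (fun j => kink ((x j - x m) / √(ε i))) j
      ≤ 2 * (1 / ε i) - if j = m then μ else 0 := fun m _ => by
    split_ifs with hjm
    · subst hjm
      have := secondDiff_kink_center_le hε h₁ h₂ H₁ H₂
      have : 0 ≤ 2 * (1 / ε i) := by positivity
      linarith
    · simpa using secondDiff_kink_le (c := x m) hε h₁ h₂
  have hsum := Finset.sum_le_sum hterm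
  rw [Finset.sum_sub_distrib, Finset.sum_const, Finset.sum_ite_eq, nsmul_eq_mul] at hsum
  have hdiff : ε i * (∑ m ∈ P, secondDiff x (fun j => kink ((x j - x m) / √(ε i))) j)
      ≤ 2 * q - if j ∈ P then ε i * μ else 0 := by
    calc _ ≤ ε i * ((P.card : ℝ) * (2 * (1 / ε i)) - if j ∈ P then μ else 0) := by gcongr
      _ = 2 * P.card - if j ∈ P then ε i * μ else 0 := by
        rw [mul_sub, mul_ite, mul_zero]; field_simp
      _ ≤ _ := by linarith
  have hconst : α * K₁ ≤ ∑ l ∈ Finset.Icc 1 n, A i l (x j) (t k) * K₁ :=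
    hA.mul_le_sum mx mt hi (c := fun _ => K₁) hK₁ fun _ _ => le_rfl
  have hcoup : -(n * (a * q))
      ≤ ∑ l ∈ Finset.Icc 1 n, A i l (x j) (t k) * ∑ m ∈ P, kink ((x j - x m) / √(ε l)) := by
    have := abs_sum_mul_le (s := Finset.Icc 1 n) (p := a) (q := q)
      (P := fun l => A i l (x j) (t k)) (Q := fun l => ∑ m ∈ P, kink ((x j - x m) / √(ε l)))
      (fun l hl => ha i hi l hl _ mx _ mt)
      (fun l _ => by
        rw [abs_of_nonneg (sum_kink_nonneg _ _ _)]
        exact (sum_kink_le _ _ _).trans hP)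
    rw [Nat.card_Icc, Nat.add_sub_cancel] at this
    exact (abs_le.1 this).1
  have hzero : ∑ l ∈ Finset.Icc 1 n, A i l (x j) (t k) * kinkBarrier ε x P K₁ K₂ l j k
      = ∑ l ∈ Finset.Icc 1 n, A i l (x j) (t k) * K₁ + K₂ * ∑ l ∈ Finset.Icc 1 n,
        A i l (x j) (t k) * ∑ m ∈ P, kink ((x j - x m) / √(ε l)) := by
    rw [Finset.mul_sum, ← Finset.sum_add_distrib]
    exact Finset.sum_congr rfl fun l _ => by rw [kinkBarrier]; ring
  have htime : kinkBarrier ε x P K₁ K₂ i j k - kinkBarrier ε x P K₁ K₂ i j (k - 1) = 0 := by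
    simp [kinkBarrier]
  rw [discreteL_eq, hsd, hzero, htime, zero_div]
  have e1 := mul_le_mul_of_nonneg_left hdiff hK₂
  have e2 := mul_le_mul_of_nonneg_left hcoup hK₂
  rw [mul_sub, mul_ite, mul_zero] at e1
  linarith

variable {f v : ℕ → ℝ → ℝ → ℝ} {V : ℕ → ℕ → ℕ → ℝ}

lemma abs_discreteL_error_le {C τ : ℝ} {i j k : ℕ} (hi : i ∈ Finset.Icc 1 n)
    (hε : 0 ≤ ε i) (hv : Smooth2 (v i)) (hvs : Solves (Finset.Icc 1 n) T ε A v f)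
    (hC : BddOnRect T (Dt (Dt (v i))) C) (mx : x j ∈ Set.Icc (0:ℝ) 1)
    (mt : t k ∈ Set.Icc (0:ℝ) T) (mt' : t (k - 1) ∈ Set.Icc (0:ℝ) T)
    (htlt : t (k - 1) < t k) (hτ : t k - t (k - 1) ≤ τ)
    (hV : discreteL n ε A x t V i j k = f i (x j) (t k)) :
    |discreteL n ε A x t (fun i j k => V i j k + (-1) * v i (x j) (t k)) i j k|
      ≤ C * τ + ε i * |secondDiff x (fun j => v i (x j) (t k)) j
        - Dx (Dx (v i)) (x j) (t k)| := by
  have hC0 : 0 ≤ C := (abs_nonneg _).trans (hC _ mx _ mt)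
  have htay := taylor_one (g := fun s => v i (x j) s) (fun z => hv.hasDerivAt_Dt (x j) z)
    (fun z => hv.dt.hasDerivAt_Dt (x j) z) (B := C) (x := t k) (y := t (k - 1))
    fun z hz => hC _ mx _ (Set.uIcc_subset_Icc mt mt' hz)
  have hd : 0 < t k - t (k - 1) := sub_pos.2 htlt
  have htime : |(v i (x j) (t k) - v i (x j) (t (k - 1))) / (t k - t (k - 1))
      - Dt (v i) (x j) (t k)| ≤ C * τ := by
    have e : (v i (x j) (t k) - v i (x j) (t (k - 1))) / (t k - t (k - 1))
      - Dt (v i) (x j) (t k) = -(v i (x j) (t (k - 1)) - v i (x j) (t k)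
        - Dt (v i) (x j) (t k) * (t (k - 1) - t k)) / (t k - t (k - 1)) := by
      field_simp; ring
    rw [e, abs_div, abs_neg, abs_of_pos hd, div_le_iff₀ hd]
    refine htay.trans ?_
    rw [abs_sub_comm, abs_of_pos hd, pow_two, ← mul_assoc]
    gcongr
  have heq := hvs i hi _ mx _ mt
  simp only at heq
  rw [discreteL_add_const_mul, hV, ← heq]
  rw [discreteL_eq]
  calc _ = |-((v i (x j) (t k) - v i (x j) (t (k - 1))) / (t k - t (k - 1))
        - Dt (v i) (x j) (t k)) + ε i * (secondDiff x (fun j => v i (x j) (t k)) j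
        - Dx (Dx (v i)) (x j) (t k))| := by congr 1; ring
    _ ≤ _ := (abs_add_le _ _).trans (by
      rw [abs_neg, abs_mul, abs_of_nonneg hε]
      gcongr)

/-- Error bound for the scheme on an arbitrary tensor mesh whose space mesh is uniform away from
the points of `P`. -/
lemma abs_error_le (hα : 0 < α) (hA : IsCoupling (Finset.Icc 1 n) T α A) {a q H τ C : ℝ}
    (ha0 : 0 ≤ a) (ha : ∀ i ∈ Finset.Icc 1 n, ∀ l ∈ Finset.Icc 1 n, BddOnRect T (A i l) a)
    {P : Finset ℕ} (hP : (P.card : ℝ) ≤ q) (hH : 0 < H) (hτ : 0 ≤ τ) (hC : 0 ≤ C)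
    (hε : ∀ i ∈ Finset.Icc 1 n, 0 < ε i)
    (hx : ∀ j ≤ N, x j ∈ Set.Icc (0:ℝ) 1) (hxlt : ∀ j < N, x j < x (j + 1))
    (hxH : ∀ j < N, x (j + 1) - x j ≤ H)
    (hxu : ∀ j, 0 < j → j < N → j ∉ P → x (j + 1) - x j = x j - x (j - 1))
    (ht : ∀ k ≤ M, t k ∈ Set.Icc (0:ℝ) T) (htlt : ∀ k < M, t k < t (k + 1))
    (htτ : ∀ k < M, t (k + 1) - t k ≤ τ)
    (hv : ∀ i ∈ Finset.Icc 1 n, Smooth2 (v i)) (hvs : Solves (Finset.Icc 1 n) T ε A v f)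
    (hvC : ∀ i ∈ Finset.Icc 1 n, BddOnRect T (Dt (Dt (v i))) C ∧ BddOnRect T (Dx (Dx (v i))) C ∧
      BddOnRect T (Dx (Dx (Dx (v i)))) (C / √(ε i)) ∧
      BddOnRect T (Dx (Dx (Dx (Dx (v i))))) (C / ε i))
    (hV : ∀ i ∈ Finset.Icc 1 n, ∀ j k, 0 < j → j < N → 0 < k → k ≤ M →
      discreteL n ε A x t V i j k = f i (x j) (t k))
    (hb : ∀ i ∈ Finset.Icc 1 n, ∀ j ≤ N, ∀ k ≤ M, (j = 0 ∨ j = N ∨ k = 0) →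
      V i j k = v i (x j) (t k)) :
    ∀ i ∈ Finset.Icc 1 n, ∀ j ≤ N, ∀ k ≤ M, |V i j k - v i (x j) (t k)|
      ≤ (C * τ + 2 * C * H ^ 2 + 2 * C * H ^ 2 * (q * (2 + n * a))) / α + 2 * C * H ^ 2 * q := by
  have hq : 0 ≤ q := (Nat.cast_nonneg _).trans hP
  set K₂ := 2 * C * H ^ 2 with hK₂
  set K₁ := (C * τ + K₂ + K₂ * (q * (2 + n * a))) / α with hK₁
  have hK₂0 : 0 ≤ K₂ := by positivity
  have hK₁0 : 0 ≤ K₁ := by positivity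
  have hαK : α * K₁ = C * τ + K₂ + K₂ * (q * (2 + n * a)) := by rw [hK₁]; field_simp
  have hLe : ∀ i ∈ Finset.Icc 1 n, ∀ j k, 0 < j → j < N → 0 < k → k ≤ M →
      |discreteL n ε A x t (fun i j k => V i j k + (-1) * v i (x j) (t k)) i j k|
        ≤ discreteL n ε A x t (kinkBarrier ε x P K₁ K₂) i j k := by
    intro i hi j k hj hjN hk hkM
    have hεi := hε i hi
    obtain ⟨b₁, b₂, b₃, b₄⟩ := hvC i hi
    have hj1 : j - 1 + 1 = j := by lia
    have hk1 : k - 1 + 1 = k := by lia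
    have mx := hx j hjN.le
    have mt := ht k hkM
    have h₁ := hxlt j hjN
    have h₂ := hxlt (j - 1) (by lia)
    have H₁ := hxH j hjN
    have H₂ := hxH (j - 1) (by lia)
    have t₁ := htlt (k - 1) (by lia)
    have t₂ := htτ (k - 1) (by lia)
    rw [hj1] at h₂ H₂
    rw [hk1] at t₁ t₂
    refine (abs_discreteL_error_le hi hεi.le (hv i hi) hvs b₁ mx mt (ht _ (by lia)) t₁ t₂
      (hV i hi j k hj hjN hk hkM)).trans ?_
    refine le_trans ?_ (le_discreteL_kinkBarrier hA ha hP hK₁0 hK₂0 hi hεi mx mt h₁ h₂ H₁ H₂)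
    have d0 : ∀ z, HasDerivAt (fun y => v i y (t k)) (Dx (v i) z (t k)) z :=
      fun z => (hv i hi).hasDerivAt_Dx z _
    have d1 : ∀ z, HasDerivAt (fun y => Dx (v i) y (t k)) (Dx (Dx (v i)) z (t k)) z :=
      fun z => (hv i hi).dx.hasDerivAt_Dx z _
    have d2 : ∀ z, HasDerivAt (fun y => Dx (Dx (v i)) y (t k)) (Dx (Dx (Dx (v i))) z (t k)) z :=
      fun z => (hv i hi).dx.dx.hasDerivAt_Dx z _
    have d3 : ∀ z, HasDerivAt (fun y => Dx (Dx (Dx (v i))) y (t k))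
        (Dx (Dx (Dx (Dx (v i)))) z (t k)) z := fun z => (hv i hi).dx.dx.dx.hasDerivAt_Dx z _
    split_ifs with hjP
    · obtain ⟨c₂, c₃⟩ := abs_secondDiff_sub_deriv_le (j := j) d0 d1 d2
        (fun z hz => b₂ z hz _ mt) (fun z hz => b₃ z hz _ mt) (hx _ (by lia)) mx
        (hx _ (by lia)) h₁ h₂ H₁ H₂
      set S := |secondDiff x (fun j => v i (x j) (t k)) j - Dx (Dx (v i)) (x j) (t k)|
      have hs0 : 0 < √(ε i) := Real.sqrt_pos.2 hεi
      have hS : S ≤ 4 * C * H * min (1 / √(ε i)) (1 / H) := by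
        rcases min_choice (1 / √(ε i)) (1 / H) with h | h <;> rw [h]
        · calc S ≤ _ := c₃
            _ = 2 * (C * H / √(ε i)) := by ring
            _ ≤ 4 * (C * H / √(ε i)) := by gcongr; norm_num
            _ = _ := by ring
        · calc S ≤ _ := c₂
            _ ≤ 4 * C := by linarith
            _ = _ := by field_simp
      have e : K₂ * (ε i * (2 * min (1 / √(ε i)) (1 / H) / H))
          = ε i * (4 * C * H * min (1 / √(ε i)) (1 / H)) := by
        rw [hK₂]; field_simp; ring
      rw [e, hαK]
      have := mul_le_mul_of_nonneg_left hS hεi.le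
      linarith
    · have c₄ := abs_secondDiff_sub_deriv_le_of_uniform (j := j) d0 d1 d2 d3
        (fun z hz => b₄ z hz _ mt) (hx _ (by lia)) mx (hx _ (by lia)) h₁ h₂ H₁
        (hxu j hj hjN hjP)
      have e : ε i * (2 * (C / ε i * H ^ 2)) = K₂ := by rw [hK₂]; field_simp
      have := mul_le_mul_of_nonneg_left c₄ hεi.le
      rw [hαK]
      linarith
  have hside : ∀ c : ℝ, |c| = 1 → ∀ i ∈ Finset.Icc 1 n, ∀ j ≤ N, ∀ k ≤ M,
      0 ≤ kinkBarrier ε x P K₁ K₂ i j k + c * (V i j k + (-1) * v i (x j) (t k)) := by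
    intro c hc
    refine nonneg_of_discreteL_nonneg hα hA (fun i hi => (hε i hi).le) hx hxlt ht htlt ?_ ?_
    · intro i hi j k hj hjN hk hkM
      rw [discreteL_add_const_mul c (kinkBarrier ε x P K₁ K₂)
        (fun i j k => V i j k + (-1) * v i (x j) (t k))]
      have h := hLe i hi j k hj hjN hk hkM
      have h' := neg_abs_le (c * discreteL n ε A x t
        (fun i j k => V i j k + (-1) * v i (x j) (t k)) i j k)
      rw [abs_mul, hc, one_mul] at h'
      linarith
    · intro i hi j hj k hk hjk
      rw [hb i hi j hj k hk hjk]
      have := mul_nonneg hK₂0 (sum_kink_nonneg (x := x) P (x j) (√(ε i)))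
      unfold kinkBarrier
      linarith
  intro i hi j hj k hk
  have hΦ : kinkBarrier ε x P K₁ K₂ i j k ≤ K₁ + K₂ * q := by
    have := mul_le_mul_of_nonneg_left ((sum_kink_le (x := x) P (x j) (√(ε i))).trans hP) hK₂0
    unfold kinkBarrier
    linarith
  have h1 := hside 1 (by simp) i hi j hj k hk
  have h2 := hside (-1) (by simp) i hi j hj k hk
  exact abs_le.2 ⟨by linarith, by linarith⟩

end DiscreteError

section ShishkinMesh

variable {α : ℝ} {ε : ℕ → ℝ} {n p N : ℕ} {xm : ℕ → ℝ}

lemma shishkinSigmaAux_bounds (hα : 0 < α) (hε : ∀ i ∈ Finset.Icc 1 n, 0 < ε i) {lnN : ℝ}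
    (hl : 0 < lnN) {m : ℕ} (hm : m < n) :
    0 < shishkinSigmaAux α lnN ε n m ∧ shishkinSigmaAux α lnN ε n m ≤ 1 / 4 := by
  have hpos : ∀ i, 1 ≤ i → i ≤ n → 0 < 2 * √(ε i / α) * lnN := fun i h1 h2 => by
    have := hε i (Finset.mem_Icc.2 ⟨h1, h2⟩)
    positivity
  induction m with
  | zero =>
    exact ⟨lt_min (by norm_num) (hpos n hm le_rfl), min_le_left _ _⟩
  | succ m ih =>
    obtain ⟨h1, h2⟩ := ih (by lia)
    exact ⟨lt_min (by linarith) (hpos _ (by lia) (by lia)),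
      (min_le_left _ _).trans (by linarith)⟩

lemma shishkinSigma_bounds (hα : 0 < α) (hε : ∀ i ∈ Finset.Icc 1 n, 0 < ε i) {R : ℝ}
    (hl : 0 < Real.log R) {r : ℕ} (hr : 1 ≤ r) (hrn : r ≤ n) :
    shishkinSigma α R ε n (r - 1) < shishkinSigma α R ε n r ∧
      0 ≤ shishkinSigma α R ε n (r - 1) ∧ shishkinSigma α R ε n r ≤ 1 / 4 := by
  have hb := shishkinSigmaAux_bounds hα hε hl (m := n - r) (by lia)
  have hr0 : r ≠ 0 := by lia
  rcases Nat.eq_or_lt_of_le hr with h | h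
  · subst h
    simpa [shishkinSigma] using hb
  · have hb' := shishkinSigmaAux_bounds hα hε hl (m := n - r + 1) (by lia)
    have hidx : n - (r - 1) = n - r + 1 := by lia
    simp only [shishkinSigma, hr0, if_neg (show r - 1 ≠ 0 by lia), if_false, hidx]
    have hle : shishkinSigmaAux α (Real.log R) ε n (n - r + 1)
      ≤ shishkinSigmaAux α (Real.log R) ε n (n - r) / 2 := min_le_left _ _
    exact ⟨by linarith [hb.1], hb'.1.le, hb.2⟩

lemma meshIdx_add_le {r : ℕ} (hr : 1 ≤ r) : meshIdx p (r - 1) + 2 ^ p ≤ meshIdx p r := by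
  rcases Nat.eq_or_lt_of_le hr with h | h
  · subst h; simp [meshIdx]
  · obtain ⟨s, rfl⟩ : ∃ s, r = s + 2 := ⟨r - 2, by lia⟩
    have e1 : meshIdx p (s + 2 - 1) = 2 ^ (s + p) := by
      simp [meshIdx, show s + 1 + p - 1 = s + p by lia]
    have e2 : meshIdx p (s + 2) = 2 ^ (s + p + 1) := by
      simp [meshIdx, show s + 2 + p - 1 = s + p + 1 by lia]
    rw [e1, e2, pow_succ]
    have : 2 ^ p ≤ 2 ^ (s + p) := Nat.pow_le_pow_right (by norm_num) (by lia)
    lia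

/-- Two consecutive points of an affine piece of a mesh. -/
lemma affine_step {s w D : ℝ} {a j : ℕ} (hj : a ≤ j) {y z : ℝ}
    (hy : y = s + ((j - a : ℕ) : ℝ) / D * w) (hz : z = s + ((j + 1 - a : ℕ) : ℝ) / D * w) :
    z - y = w / D := by
  rw [hy, hz, Nat.cast_sub hj, Nat.cast_sub (by lia)]
  push_cast
  ring

namespace IsShishkinMesh

lemma left_step (h : IsShishkinMesh α ε n p N xm) {r : ℕ} (hr : 1 ≤ r) (hrn : r ≤ n) {j : ℕ}
    (hj : meshIdx p (r - 1) ≤ j) (hj' : j < meshIdx p r) :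
    xm (j + 1) - xm j = (shishkinSigma α N ε n r - shishkinSigma α N ε n (r - 1))
      / ((meshIdx p r - meshIdx p (r - 1) : ℕ) : ℝ) :=
  affine_step hj (h.2.2.1 r hr hrn j hj hj'.le)
    (h.2.2.1 r hr hrn (j + 1) (by lia) (by lia))

lemma middle_step (h : IsShishkinMesh α ε n p N xm) {j : ℕ} (hj : N / 4 ≤ j)
    (hj' : j < N - N / 4) :
    xm (j + 1) - xm j = (1 - 2 * shishkinSigma α N ε n n) / ((N / 2 : ℕ) : ℝ) :=
  affine_step hj (h.2.2.2.1 j hj hj'.le) (h.2.2.2.1 (j + 1) (by lia) (by lia))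

lemma right_step (h : IsShishkinMesh α ε n p N xm) {j : ℕ} (hj : j < N) :
    xm (j + 1) - xm j = xm (N - (j + 1) + 1) - xm (N - (j + 1)) := by
  rw [h.2.2.2.2 (j + 1) hj, show N - (j + 1) + 1 = N - j by lia, h.2.2.2.2 j hj.le]
  ring

end IsShishkinMesh

/-- Every index in the left layer region lies in one of the uniform pieces. -/
lemma exists_meshIdx_piece {j : ℕ} (hj : j < meshIdx p n) :
    ∃ r, 1 ≤ r ∧ r ≤ n ∧ meshIdx p (r - 1) ≤ j ∧ j < meshIdx p r := by
  classical
  have hex : ∃ r, j < meshIdx p r := ⟨n, hj⟩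
  have h0 : Nat.find hex ≠ 0 := fun h => by
    have := Nat.find_spec hex
    rw [h] at this
    simp [meshIdx] at this
  exact ⟨Nat.find hex, by lia, Nat.find_min' hex hj,
    not_lt.1 (Nat.find_min hex (m := Nat.find hex - 1) (by lia)), Nat.find_spec hex⟩

/-- The Shishkin mesh has positive steps of size `O(1 / N)` and is uniform away from at most `2n`
transition points. -/
lemma IsShishkinMesh.exists_uniform_off (hn : 1 ≤ n) (hα : 0 < α) (hε : ∀ i ∈ Finset.Icc 1 n, 0 < ε i)
    (hN : N = 2 ^ (n + p + 1)) (hl : 0 < Real.log N) (h : IsShishkinMesh α ε n p N xm) :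
    ∃ P : Finset ℕ, P.card ≤ 2 * n ∧
      (∀ j < N, xm j < xm (j + 1) ∧ xm (j + 1) - xm j ≤ 2 ^ n / N) ∧
      ∀ j, 0 < j → j < N → j ∉ P → xm (j + 1) - xm j = xm j - xm (j - 1) := by
  have hNn : N = 4 * meshIdx p n := by
    rw [hN, meshIdx, if_neg (by lia), show n + p + 1 = n + p - 1 + 2 by lia, pow_add]
    ring
  have hN4 : N / 4 = meshIdx p n := by lia
  have hNR : (N : ℝ) = 2 ^ n * 2 ^ p * 2 := by rw [hN]; push_cast; ring
  have hσ := shishkinSigma_bounds hα hε hl hn le_rfl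
  have hleft : ∀ j < N / 4, 0 < xm (j + 1) - xm j ∧ xm (j + 1) - xm j ≤ 2 ^ n / N := by
    intro j hj
    obtain ⟨r, hr, hrn, h1, h2⟩ := exists_meshIdx_piece (hN4 ▸ hj)
    obtain ⟨s1, s2, s3⟩ := shishkinSigma_bounds hα hε hl hr hrn
    have hD : (2:ℝ) ^ p ≤ ((meshIdx p r - meshIdx p (r - 1) : ℕ) : ℝ) := by
      have := meshIdx_add_le (p := p) hr
      exact_mod_cast (show 2 ^ p ≤ meshIdx p r - meshIdx p (r - 1) by lia)
    have hD0 : (0:ℝ) < ((meshIdx p r - meshIdx p (r - 1) : ℕ) : ℝ) :=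
      lt_of_lt_of_le (by positivity) hD
    rw [h.left_step hr hrn h1 h2]
    refine ⟨div_pos (by linarith) hD0, ?_⟩
    calc _ ≤ (1 / 2) / (2:ℝ) ^ p := by gcongr; linarith
      _ = _ := by rw [hNR]; field_simp
  have hstep : ∀ j < N, 0 < xm (j + 1) - xm j ∧ xm (j + 1) - xm j ≤ 2 ^ n / N := by
    intro j hj
    rcases lt_or_ge j (N / 4) with h1 | h1
    · exact hleft j h1
    rcases lt_or_ge j (N - N / 4) with h2 | h2
    · rw [h.middle_step h1 h2]
      have hN2 : ((N / 2 : ℕ) : ℝ) = N / 2 := Nat.cast_div (by lia) (by norm_num)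
      have hNpos : (0:ℝ) < N := by rw [hNR]; positivity
      rw [hN2]
      refine ⟨div_pos (by linarith) (by positivity), ?_⟩
      have h2n : (2:ℝ) ≤ 2 ^ n := by
        calc (2:ℝ) = 2 ^ 1 := by norm_num
          _ ≤ _ := pow_le_pow_right₀ (by norm_num) hn
      calc _ ≤ 1 / ((N:ℝ) / 2) := by gcongr; linarith
        _ = 2 / N := by field_simp
        _ ≤ _ := by gcongr
    · rw [h.right_step hj]
      exact hleft _ (by lia)
  have hunif : ∀ j, 0 < j → j < N / 4 → (∀ r ∈ Finset.Icc 1 n, j ≠ meshIdx p r) →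
      xm (j + 1) - xm j = xm (j - 1 + 1) - xm (j - 1) := by
    intro j hj0 hj hjP
    obtain ⟨r, hr, hrn, h1, h2⟩ := exists_meshIdx_piece (hN4 ▸ hj)
    have hne : j ≠ meshIdx p (r - 1) := by
      rcases Nat.eq_or_lt_of_le hr with h | h
      · subst h; simp [meshIdx]; lia
      · exact hjP _ (Finset.mem_Icc.2 ⟨by lia, by lia⟩)
    rw [h.left_step hr hrn h1 h2, h.left_step (j := j - 1) hr hrn (by lia) (by lia)]
  refine ⟨(Finset.Icc 1 n).image (meshIdx p) ∪ (Finset.Icc 1 n).image (fun r => N - meshIdx p r),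
    ?_, fun j hj => ⟨sub_pos.1 (hstep j hj).1, (hstep j hj).2⟩, ?_⟩
  · refine (Finset.card_union_le _ _).trans ?_
    have h1 := Finset.card_image_le (s := Finset.Icc 1 n) (f := meshIdx p)
    have h2 := Finset.card_image_le (s := Finset.Icc 1 n) (f := fun r => N - meshIdx p r)
    rw [Nat.card_Icc] at h1 h2
    lia
  · intro j hj0 hj hjP
    rw [Finset.mem_union, not_or] at hjP
    have hP₁ : ∀ r ∈ Finset.Icc 1 n, j ≠ meshIdx p r := fun r hr e =>
      hjP.1 (Finset.mem_image.2 ⟨r, hr, e.symm⟩)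
    have hP₂ : ∀ r ∈ Finset.Icc 1 n, j ≠ N - meshIdx p r := fun r hr e =>
      hjP.2 (Finset.mem_image.2 ⟨r, hr, e.symm⟩)
    have hnn : n ∈ Finset.Icc 1 n := Finset.mem_Icc.2 ⟨hn, le_rfl⟩
    have e₁ := hP₁ n hnn
    have e₂ := hP₂ n hnn
    have hj1 : j - 1 + 1 = j := by lia
    suffices xm (j + 1) - xm j = xm (j - 1 + 1) - xm (j - 1) by rwa [hj1] at this
    rcases lt_or_ge j (N / 4) with h1 | h1
    · exact hunif j hj0 h1 hP₁
    rcases lt_or_ge j (N - N / 4) with h2 | h2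
    · rw [h.middle_step h1 h2, h.middle_step (j := j - 1) (by lia) (by lia)]
    · rw [h.right_step hj, h.right_step (j := j - 1) (by lia), hj1]
      have := hunif (N - j) (by lia) (by lia) fun r hr e => hP₂ r hr (by lia)
      rw [this, show N - (j + 1) = N - j - 1 by lia]

lemma IsShishkinMesh.mem_Icc (h : IsShishkinMesh α ε n p N xm)
    (hlt : ∀ j < N, xm j < xm (j + 1)) {j : ℕ} (hj : j ≤ N) : xm j ∈ Set.Icc (0:ℝ) 1 := by
  have hmono : ∀ a b, a ≤ b → b ≤ N → xm a ≤ xm b := fun a b hab => by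
    induction b, hab using Nat.le_induction with
    | base => exact fun _ => le_rfl
    | succ b _ ih => exact fun hb => (ih (by lia)).trans (hlt b (by lia)).le
  exact ⟨h.1 ▸ hmono 0 j (Nat.zero_le j) hj, h.2.1 ▸ hmono j N hj le_rfl⟩

end ShishkinMesh

/-- **Error estimate for the smooth component** (Theorem 1 of the paper):
there is a constant `C`, independent of `ε₁,…,εₙ`, `M` and `N`, such that
`‖V − v‖ ≤ C(M⁻¹ + N⁻²(ln N)³)`, where `v` is the smooth component of the
exact solution and `V` solves the discrete problem `L^{M,N}V = f` at the
interior points of the Shishkin mesh with `V = v` at the boundary mesh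
points. -/
theorem stmt_18
    (n : ℕ) (hn : 1 ≤ n) (T : ℝ) (hT : 0 < T)
    (A : ℕ → ℕ → ℝ → ℝ → ℝ)
    (hAsmooth : ∀ i ∈ Finset.Icc 1 n, ∀ j ∈ Finset.Icc 1 n,
      ContDiff ℝ (⊤ : ℕ∞) (fun p : ℝ × ℝ => A i j p.1 p.2))
    (hAdiag : ∀ i ∈ Finset.Icc 1 n, ∀ x ∈ Set.Icc (0:ℝ) 1, ∀ t ∈ Set.Icc (0:ℝ) T,
      ∑ j ∈ (Finset.Icc 1 n).erase i, |A i j x t| < A i i x t)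
    (hAoff : ∀ i ∈ Finset.Icc 1 n, ∀ j ∈ Finset.Icc 1 n, i ≠ j →
      ∀ x ∈ Set.Icc (0:ℝ) 1, ∀ t ∈ Set.Icc (0:ℝ) T, A i j x t ≤ 0)
    (α : ℝ) (hα : 0 < α)
    (hαA : ∀ x ∈ Set.Icc (0:ℝ) 1, ∀ t ∈ Set.Icc (0:ℝ) T, ∀ i ∈ Finset.Icc 1 n,
      α < ∑ j ∈ Finset.Icc 1 n, A i j x t)
    (f φ : ℕ → ℝ → ℝ → ℝ)
    (hfsmooth : ∀ i ∈ Finset.Icc 1 n, ContDiff ℝ (⊤ : ℕ∞) (fun p : ℝ × ℝ => f i p.1 p.2))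
    (hφsmooth : ∀ i ∈ Finset.Icc 1 n, ContDiff ℝ (⊤ : ℕ∞) (fun p : ℝ × ℝ => φ i p.1 p.2)) :
    ∃ C : ℝ, 0 < C ∧
      ∀ ε : ℕ → ℝ,
        (∀ i ∈ Finset.Icc 1 n, 0 < ε i) →
        (∀ i ∈ Finset.Icc 1 n, ε i ≤ 1) →
        (∀ i j : ℕ, 1 ≤ i → i < j → j ≤ n → ε i < ε j) →
        (∀ i ∈ Finset.Icc 1 n, Real.sqrt (ε i) ≤ Real.sqrt α / 6) →
      ∀ p M N : ℕ, 1 ≤ M → N = 2 ^ (n + p + 1) →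
      ∀ xm : ℕ → ℝ, IsShishkinMesh α ε n p N xm →
      ∀ u₀ v : ℕ → ℝ → ℝ → ℝ,
        (∀ i ∈ Finset.Icc 1 n, ContDiff ℝ (⊤ : ℕ∞) (fun q : ℝ × ℝ => u₀ i q.1 q.2)) →
        (∀ i ∈ Finset.Icc 1 n, ContDiff ℝ (⊤ : ℕ∞) (fun q : ℝ × ℝ => v i q.1 q.2)) →
        -- `u₀` solves the reduced problem on `Ω` with `u₀ = φ` on `Γ_B`
        (∀ i ∈ Finset.Icc 1 n, ∀ x t : ℝ, 0 < x → x < 1 → 0 < t → t ≤ T →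
          deriv (fun s => u₀ i x s) t + ∑ j ∈ Finset.Icc 1 n, A i j x t * u₀ j x t
            = f i x t) →
        (∀ i ∈ Finset.Icc 1 n, ∀ x ∈ Set.Icc (0:ℝ) 1, u₀ i x 0 = φ i x 0) →
        -- `v` is the smooth component: `Lv = f` on `Ω`, `v = u₀` on `Γ`
        (∀ i ∈ Finset.Icc 1 n, ∀ x t : ℝ, 0 < x → x < 1 → 0 < t → t ≤ T →
          deriv (fun s => v i x s) t - ε i * iteratedDeriv 2 (fun y => v i y t) x
            + ∑ j ∈ Finset.Icc 1 n, A i j x t * v j x t = f i x t) →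
        (∀ i ∈ Finset.Icc 1 n, ∀ x ∈ Set.Icc (0:ℝ) 1, ∀ t ∈ Set.Icc (0:ℝ) T,
          (x = 0 ∨ x = 1 ∨ t = 0) → v i x t = u₀ i x t) →
      ∀ V : ℕ → ℕ → ℕ → ℝ,
        -- `V` solves the discrete problem with boundary values `v`
        (∀ i ∈ Finset.Icc 1 n, ∀ j k : ℕ, 0 < j → j < N → 0 < k → k ≤ M →
          discreteL n ε A xm (fun k' => (k' : ℝ) * T / M) V i j k
            = f i (xm j) ((k : ℝ) * T / M)) →
        (∀ i ∈ Finset.Icc 1 n, ∀ j ≤ N, ∀ k ≤ M, (j = 0 ∨ j = N ∨ k = 0) →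
          V i j k = v i (xm j) ((k : ℝ) * T / M)) →
      ∀ i ∈ Finset.Icc 1 n, ∀ j ≤ N, ∀ k ≤ M,
        |V i j k - v i (xm j) ((k : ℝ) * T / M)|
          ≤ C * ((M : ℝ)⁻¹ + ((N : ℝ) ^ 2)⁻¹ * (Real.log N) ^ 3) := by
  have hA : IsCoupling (Finset.Icc 1 n) T α A := ⟨hAsmooth, hAoff, hαA⟩
  obtain ⟨C, hC, hbound⟩ := exists_smooth_component_bounds hT hα hA hfsmooth hφsmooth
  obtain ⟨a, ha0, ha⟩ := Smooth2.exists_bdd_family₂ T hAsmooth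
  set B : ℝ := (1 + 2 * n * (2 + n * a)) / α + 2 * n with hB
  have hB0 : 0 ≤ B := by positivity
  refine ⟨C * T / α + 2 * C * (2 ^ n) ^ 2 * B, by positivity, ?_⟩
  intro ε hε hε1 _ _ p M N hM hN xm hxm u₀ v hu hv hue hu0 hve hvb V hV hVb
  have hMpos : (0:ℝ) < M := by exact_mod_cast hM
  have hN4 : (4:ℝ) ≤ N := by
    have : 2 ^ 2 ≤ 2 ^ (n + p + 1) := Nat.pow_le_pow_right (by norm_num) (by lia)
    rw [hN]
    exact_mod_cast this
  have hNpos : (0:ℝ) < N := by linarith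
  have hlog : 1 ≤ Real.log N := by
    rw [Real.le_log_iff_exp_le hNpos]
    linarith [Real.exp_one_lt_three]
  have hus : Solves (Finset.Icc 1 n) T (fun _ => 0) A u₀ f := fun i hi =>
    EqOnRect.of_interior hT (smooth_lhs (ε := fun _ => 0) hA hu hi) (hfsmooth i hi) fun x t h0 h1 h2 h3 => by
      simpa [Dt] using hue i hi x t h0 h1 h2 h3
  have hvs : Solves (Finset.Icc 1 n) T ε A v f := fun i hi =>
    EqOnRect.of_interior hT (smooth_lhs hA hv hi) (hfsmooth i hi) fun x t h0 h1 h2 h3 => by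
      have := hve i hi x t h0 h1 h2 h3
      rwa [iteratedDeriv_succ, iteratedDeriv_one] at this
  obtain ⟨P, hPcard, hstep, hunif⟩ := hxm.exists_uniform_off hn hα hε hN (by linarith)
  have hP : (P.card : ℝ) ≤ 2 * n := by exact_mod_cast hPcard
  have hτ : ∀ k : ℕ, ((k + 1 : ℕ) : ℝ) * T / M - (k : ℝ) * T / M = T / M := fun k => by
    push_cast; ring
  have hτ0 : 0 < T / M := by positivity
  have herr := abs_error_le (t := fun k => (k : ℝ) * T / M) (H := 2 ^ n / N) (τ := T / M)
    hα hA ha0 ha hP (by positivity) hτ0.le hC.le hε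
    (fun j hj => hxm.mem_Icc (fun j hj => (hstep j hj).1) hj) (fun j hj => (hstep j hj).1)
    (fun j hj => (hstep j hj).2) hunif
    (fun k hk => ⟨by positivity, by
      have : (k : ℝ) ≤ M := by exact_mod_cast hk
      rw [div_le_iff₀ hMpos, mul_comm T]
      gcongr⟩)
    (fun k _ => by linarith [hτ k]) (fun k _ => (hτ k).le) hv hvs
    (hbound ε u₀ v hε hε1 hu hv hus hu0 hvs hvb) hV hVb
  intro i hi j hj k hk
  refine (herr i hi j hj k hk).trans ?_
  have hpow : ((N:ℝ) ^ 2)⁻¹ ≤ ((N:ℝ) ^ 2)⁻¹ * Real.log N ^ 3 :=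
    le_mul_of_one_le_right (by positivity) (one_le_pow₀ hlog)
  calc _ = C * T / α * (M:ℝ)⁻¹ + 2 * C * (2 ^ n) ^ 2 * B * ((N:ℝ) ^ 2)⁻¹ := by
        rw [hB]; field_simp; ring
    _ ≤ C * T / α * ((M:ℝ)⁻¹ + ((N:ℝ) ^ 2)⁻¹ * Real.log N ^ 3)
        + 2 * C * (2 ^ n) ^ 2 * B * ((M:ℝ)⁻¹ + ((N:ℝ) ^ 2)⁻¹ * Real.log N ^ 3) := by
      have : 0 ≤ (M:ℝ)⁻¹ := by positivity
      have : 0 ≤ ((N:ℝ) ^ 2)⁻¹ := by positivity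
      gcongr <;> linarith
    _ = _ := by ring
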